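/- arXiv:0809.4269 — 2 statements merged into one kernel-verified Lean document; each statement's English description precedes it below -/
import Mathlib

section
/- Schrödinger–Lichnerowicz formula (local coordinate form): for every λ ∈ ℝ with λ ≠ 0 and every smooth spinor field ψ : U → Cl_λ(n), D(Dψ) = λ·Δ^{(σ)}ψ − (λ/4)·R·ψ pointwise on U, where Dψ := Σ_A γ^A·(∂_Aψ − Ω_A·ψ) and Δ^{(σ)}ψ := (1/ρ_g)·Σ_{A,B} (∂_A − Ω_A·)(ρ_g·g^{AB}·(∂_Bψ − Ω_B·ψ)), and R is the Levi–Civita scalar curvature of the induced metric. -/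
/-- The `A`-th partial derivative of a function `f : ℝⁿ → ℝ`. -/
noncomputable def pd {n : ℕ} (A : Fin n) (f : (Fin n → ℝ) → ℝ) (z : Fin n → ℝ) : ℝ :=
  fderiv ℝ f z (Pi.single A 1)

/-- The Laplacian `Δ_ρ f := (1/ρ)·Σ_{A,B} ∂_A(ρ g^{AB} ∂_B f)`. -/
noncomputable def lap {n : ℕ} (ρ : (Fin n → ℝ) → ℝ) (g : (Fin n → ℝ) → Fin n → Fin n → ℝ)
    (f : (Fin n → ℝ) → ℝ) (z : Fin n → ℝ) : ℝ :=
  (ρ z)⁻¹ * ∑ A, ∑ B, pd A (fun w => ρ w * g w A B * pd B f w) z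

/-- Lowered Levi–Civita Christoffel symbols
`Γ_{CAB} := ½(∂_A g_{CB} + ∂_B g_{CA} − ∂_C g_{AB})`. -/
noncomputable def christLow {n : ℕ} (gl : (Fin n → ℝ) → Fin n → Fin n → ℝ)
    (C A B : Fin n) (z : Fin n → ℝ) : ℝ :=
  (pd A (fun u => gl u C B) z + pd B (fun u => gl u C A) z - pd C (fun u => gl u A B) z) / 2

/-- Levi–Civita Christoffel symbols `Γ^A{}_{BC} := Σ_D g^{AD} Γ_{DBC}`. -/
noncomputable def christ {n : ℕ} (g gl : (Fin n → ℝ) → Fin n → Fin n → ℝ)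
    (A B C : Fin n) (z : Fin n → ℝ) : ℝ :=
  ∑ D, g z A D * christLow gl D B C z

/-- Riemann curvature `R^D{}_{ABC}` of the Levi–Civita connection. -/
noncomputable def riem {n : ℕ} (g gl : (Fin n → ℝ) → Fin n → Fin n → ℝ)
    (D A B C : Fin n) (z : Fin n → ℝ) : ℝ :=
  pd A (christ g gl D B C) z - pd B (christ g gl D A C) z
    + ∑ E, (christ g gl D A E z * christ g gl E B C z
            - christ g gl D B E z * christ g gl E A C z)

/-- Ricci tensor `R_{AB} := Σ_C R^C{}_{CAB}`. -/
noncomputable def ricci {n : ℕ} (g gl : (Fin n → ℝ) → Fin n → Fin n → ℝ)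
    (A B : Fin n) (z : Fin n → ℝ) : ℝ :=
  ∑ C, riem g gl C C A B z

/-- Scalar curvature `R := Σ g^{BA} R_{AB}`. -/
noncomputable def scal {n : ℕ} (g gl : (Fin n → ℝ) → Fin n → Fin n → ℝ)
    (z : Fin n → ℝ) : ℝ :=
  ∑ A, ∑ B, g z B A * ricci g gl A B z

/-- The metric `g_{AB} := Σ_a e^a{}_A·e^a{}_B` induced by a vielbein `e`. -/
noncomputable def glowE {n : ℕ} (e : (Fin n → ℝ) → Fin n → Fin n → ℝ) :
    (Fin n → ℝ) → Fin n → Fin n → ℝ :=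
  fun z A B => ∑ a, e z a A * e z a B

/-- The density `ρ_g := det e` determined by the vielbein. -/
noncomputable def rhoE {n : ℕ} (e : (Fin n → ℝ) → Fin n → Fin n → ℝ) (z : Fin n → ℝ) : ℝ :=
  Matrix.det (Matrix.of fun a A => e z a A)

/-- The spin connection `ω^b{}_{Ac} := Σ_{B,C} e^b{}_B Γ^B{}_{AC} e^C{}_c − Σ_C (∂_A e^b{}_C)·e^C{}_c`
determined by the vielbein `e` and the Levi–Civita connection of the induced metric
(`gup` denotes the inverse metric `g^{AB}`). -/
noncomputable def spinConnE {n : ℕ} (e eInv gup : (Fin n → ℝ) → Fin n → Fin n → ℝ)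
    (b A c : Fin n) (z : Fin n → ℝ) : ℝ :=
  (∑ B, ∑ C, e z b B * christ gup (glowE e) B A C z * eInv z C c)
    - ∑ C, pd A (fun w => e w b C) z * eInv z C c

/-- The flat gamma matrix `γ_a`: the image of the `a`-th standard basis vector in the
Clifford algebra. -/
noncomputable def gammaFlat {n : ℕ} (Q : QuadraticForm ℝ (EuclideanSpace ℝ (Fin n)))
    (a : Fin n) : CliffordAlgebra Q :=
  CliffordAlgebra.ι Q (EuclideanSpace.single a (1 : ℝ))

/-- The spin connection term `Ω_A := (1/(8λ))·Σ_{b,c} ω^b{}_{Ac}·(γ_c·γ_b − γ_b·γ_c)`. -/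
noncomputable def OmegaSpin {n : ℕ} (Q : QuadraticForm ℝ (EuclideanSpace ℝ (Fin n)))
    (lam : ℝ) (e eInv gup : (Fin n → ℝ) → Fin n → Fin n → ℝ)
    (A : Fin n) (z : Fin n → ℝ) : CliffordAlgebra Q :=
  (1 / (8 * lam)) • ∑ b, ∑ c, spinConnE e eInv gup b A c z •
    (gammaFlat Q c * gammaFlat Q b - gammaFlat Q b * gammaFlat Q c)

/-- The curved gamma matrices `γ^A := Σ_a e^A{}_a·γ_a`. -/
noncomputable def gammaCurved {n : ℕ} (Q : QuadraticForm ℝ (EuclideanSpace ℝ (Fin n)))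
    (eInv : (Fin n → ℝ) → Fin n → Fin n → ℝ) (A : Fin n) (z : Fin n → ℝ) :
    CliffordAlgebra Q :=
  ∑ a, eInv z A a • gammaFlat Q a

/-- The Dirac operator `Dψ := Σ_A γ^A·(∂_Aψ − Ω_A·ψ)` on spinor fields, expressed through a
given family `dψ` of partial derivatives of `ψ`. -/
noncomputable def diracSpin {n : ℕ} (Q : QuadraticForm ℝ (EuclideanSpace ℝ (Fin n)))
    (lam : ℝ) (e eInv gup : (Fin n → ℝ) → Fin n → Fin n → ℝ)
    (ψ : (Fin n → ℝ) → CliffordAlgebra Q) (dψ : Fin n → (Fin n → ℝ) → CliffordAlgebra Q)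
    (w : Fin n → ℝ) : CliffordAlgebra Q :=
  ∑ A, gammaCurved Q eInv A w * (dψ A w - OmegaSpin Q lam e eInv gup A w * ψ w)

/-- The inner function `ρ_g·g^{AB}·(∂_Bψ − Ω_B·ψ)` appearing in the spinor Laplacian. -/
noncomputable def innerSpinLap {n : ℕ} (Q : QuadraticForm ℝ (EuclideanSpace ℝ (Fin n)))
    (lam : ℝ) (e eInv gup : (Fin n → ℝ) → Fin n → Fin n → ℝ)
    (ψ : (Fin n → ℝ) → CliffordAlgebra Q) (dψ : Fin n → (Fin n → ℝ) → CliffordAlgebra Q)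
    (A B : Fin n) (w : Fin n → ℝ) : CliffordAlgebra Q :=
  (rhoE e w * gup w A B) • (dψ B w - OmegaSpin Q lam e eInv gup B w * ψ w)

namespace Lichnerowicz

open Module

section ScalarCalculus

variable {n : ℕ} {U : Set (Fin n → ℝ)} {A B : Fin n} {f g : (Fin n → ℝ) → ℝ} {z : Fin n → ℝ}

/-- Smoothness of a real-valued function on a set. -/
abbrev Smooth (U : Set (Fin n → ℝ)) (f : (Fin n → ℝ) → ℝ) : Prop :=
  ContDiffOn ℝ (⊤ : ℕ∞) f U

theorem Smooth.differentiableAt (hf : Smooth U f) (hU : IsOpen U) (hz : z ∈ U) :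
    DifferentiableAt ℝ f z :=
  (hf.contDiffAt (hU.mem_nhds hz)).differentiableAt (by simp)

theorem Smooth.partialDeriv (hf : Smooth U f) (hU : IsOpen U) : Smooth U (pd A f) :=
  (ContDiffOn.fderiv_of_isOpen hf hU (by simp)).clm_apply contDiffOn_const

theorem pd_congr (hU : IsOpen U) (hz : z ∈ U) (h : ∀ w ∈ U, f w = g w) :
    pd A f z = pd A g z := by
  have : f =ᶠ[nhds z] g := Filter.eventuallyEq_of_mem (hU.mem_nhds hz) h
  simp only [pd, this.fderiv_eq]

theorem pd_const (c : ℝ) : pd A (fun _ => c) z = 0 := by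
  simp [pd]

theorem pd_sub (hf : DifferentiableAt ℝ f z) (hg : DifferentiableAt ℝ g z) :
    pd A (fun w => f w - g w) z = pd A f z - pd A g z := by
  simp [pd, fderiv_fun_sub hf hg]

theorem pd_mul (hf : DifferentiableAt ℝ f z) (hg : DifferentiableAt ℝ g z) :
    pd A (fun w => f w * g w) z = pd A f z * g z + f z * pd A g z := by
  simp [pd, fderiv_fun_mul hf hg]
  ring

theorem pd_sum {ι : Type*} (s : Finset ι) {F : ι → (Fin n → ℝ) → ℝ}
    (hF : ∀ i ∈ s, DifferentiableAt ℝ (F i) z) :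
    pd A (fun w => ∑ i ∈ s, F i w) z = ∑ i ∈ s, pd A (F i) z := by
  simp [pd, fderiv_fun_sum hF]

theorem pd_comm (hU : IsOpen U) (hf : Smooth U f) (hz : z ∈ U) :
    pd A (pd B f) z = pd B (pd A f) z := by
  have hc := hf.contDiffAt (hU.mem_nhds hz)
  have hd : DifferentiableAt ℝ (fderiv ℝ f) z :=
    ((ContDiffOn.fderiv_of_isOpen (m := (⊤ : ℕ∞)) hf hU (by simp)).contDiffAt
      (hU.mem_nhds hz)).differentiableAt (by simp)
  have key : ∀ C D : Fin n, pd C (pd D f) z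
      = fderiv ℝ (fderiv ℝ f) z (Pi.single C 1) (Pi.single D 1) := by
    intro C D
    have : pd D f = fun w => fderiv ℝ f w (Pi.single D 1) := rfl
    rw [this, pd, fderiv_clm_apply hd (differentiableAt_const _)]
    simp
  rw [key, key]
  refine (hc.isSymmSndFDerivAt ?_).eq _ _
  rw [minSmoothness_of_isRCLikeNormedField]
  exact ENat.LEInfty.out

end ScalarCalculus

section VectorCalculus

variable {n : ℕ} {U : Set (Fin n → ℝ)} {A B : Fin n} {z : Fin n → ℝ}
variable {V : Type*} [AddCommGroup V] [Module ℝ V]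

theorem eq_of_forall_dual {x y : V} (h : ∀ φ : Dual ℝ V, φ x = φ y) : x = y := by
  rw [← sub_eq_zero, ← forall_dual_apply_eq_zero_iff ℝ]
  intro φ
  rw [map_sub, h, sub_self]

/-- Smoothness of a vector-valued function, tested on linear functionals. -/
def VSmooth (U : Set (Fin n → ℝ)) (F : (Fin n → ℝ) → V) : Prop :=
  ∀ φ : Dual ℝ V, Smooth U (fun w => φ (F w))

theorem VSmooth.congr {F G : (Fin n → ℝ) → V} (hF : VSmooth U F) (h : ∀ w ∈ U, G w = F w) :
    VSmooth U G :=
  fun φ => (hF φ).congr fun w hw => by rw [h w hw]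

theorem VSmooth.const (v : V) : VSmooth U (fun _ => v) :=
  fun _ => contDiffOn_const

theorem VSmooth.sub {F G : (Fin n → ℝ) → V} (hF : VSmooth U F) (hG : VSmooth U G) :
    VSmooth U (fun w => F w - G w) := fun φ => by
  simpa only [map_sub] using ContDiffOn.sub (hF φ) (hG φ)

theorem VSmooth.smul {f : (Fin n → ℝ) → ℝ} {F : (Fin n → ℝ) → V} (hf : Smooth U f)
    (hF : VSmooth U F) : VSmooth U (fun w => f w • F w) := fun φ => by
  simpa only [map_smul, smul_eq_mul] using ContDiffOn.mul hf (hF φ)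

theorem VSmooth.sum {ι : Type*} {s : Finset ι} {F : ι → (Fin n → ℝ) → V}
    (hF : ∀ i ∈ s, VSmooth U (F i)) : VSmooth U (fun w => ∑ i ∈ s, F i w) := fun φ => by
  simpa only [map_sum] using ContDiffOn.sum fun i hi => hF i hi φ

variable [Module.Finite ℝ V]

/-- The `A`-th partial derivative of a function with values in a finite-dimensional space. -/
noncomputable def vpd (A : Fin n) (F : (Fin n → ℝ) → V) (z : Fin n → ℝ) : V :=
  ∑ i, pd A (fun w => (finBasis ℝ V).coord i (F w)) z • finBasis ℝ V i

theorem dual_eq_sum_coord (φ : Dual ℝ V) (v : V) :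
    φ v = ∑ i, (finBasis ℝ V).coord i v * φ (finBasis ℝ V i) := by
  conv_lhs => rw [← (finBasis ℝ V).sum_repr v]
  simp only [map_sum, map_smul, smul_eq_mul, Basis.coord_apply]

theorem dual_vpd (hU : IsOpen U) {F : (Fin n → ℝ) → V} (hF : VSmooth U F) (hz : z ∈ U)
    (φ : Dual ℝ V) : φ (vpd A F z) = pd A (fun w => φ (F w)) z := by
  have h : (fun w => φ (F w)) =
      fun w => ∑ i, (finBasis ℝ V).coord i (F w) * φ (finBasis ℝ V i) := by
    funext w
    exact dual_eq_sum_coord φ _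
  have hd := fun i => (hF ((finBasis ℝ V).coord i)).differentiableAt hU hz
  rw [h, pd_sum _ fun i _ => (hd i).fun_mul (differentiableAt_const _), vpd, map_sum]
  refine Finset.sum_congr rfl fun i _ => ?_
  rw [pd_mul (hd i) (differentiableAt_const _), pd_const]
  simp

theorem eq_vpd (hU : IsOpen U) {F : (Fin n → ℝ) → V} (hF : VSmooth U F) (hz : z ∈ U) {v : V}
    (h : ∀ φ : Dual ℝ V, φ v = pd A (fun w => φ (F w)) z) : v = vpd A F z :=
  eq_of_forall_dual fun φ => by rw [h, dual_vpd hU hF hz]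

theorem VSmooth.partialDeriv (hU : IsOpen U) {F : (Fin n → ℝ) → V} (hF : VSmooth U F) :
    VSmooth U (vpd A F) := fun φ =>
  ((hF φ).partialDeriv hU).congr fun _ hw => dual_vpd hU hF hw φ

theorem vpd_congr (hU : IsOpen U) (hz : z ∈ U) {F G : (Fin n → ℝ) → V}
    (h : ∀ w ∈ U, F w = G w) : vpd A F z = vpd A G z := by
  refine Finset.sum_congr rfl fun i _ => ?_
  rw [pd_congr hU hz fun w hw => by rw [h w hw]]

theorem vpd_comm (hU : IsOpen U) {F : (Fin n → ℝ) → V} (hF : VSmooth U F) (hz : z ∈ U) :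
    vpd A (vpd B F) z = vpd B (vpd A F) z := by
  refine eq_of_forall_dual fun φ => ?_
  rw [dual_vpd hU (hF.partialDeriv hU) hz, dual_vpd hU (hF.partialDeriv hU) hz,
    pd_congr hU hz fun w hw => dual_vpd hU hF hw φ,
    pd_congr (A := B) hU hz fun w hw => dual_vpd hU hF hw φ]
  exact pd_comm hU (hF φ) hz

theorem vpd_const (hU : IsOpen U) (hz : z ∈ U) (v : V) : vpd A (fun _ => v) z = 0 :=
  (eq_vpd hU (VSmooth.const v) hz fun φ => by rw [pd_const, map_zero]).symm

theorem vpd_sub (hU : IsOpen U) {F G : (Fin n → ℝ) → V} (hF : VSmooth U F) (hG : VSmooth U G)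
    (hz : z ∈ U) : vpd A (fun w => F w - G w) z = vpd A F z - vpd A G z :=
  (eq_vpd hU (hF.sub hG) hz fun φ => by
    simp only [map_sub]
    rw [pd_sub ((hF φ).differentiableAt hU hz) ((hG φ).differentiableAt hU hz),
      dual_vpd hU hF hz, dual_vpd hU hG hz]).symm

theorem vpd_sum (hU : IsOpen U) {ι : Type*} {s : Finset ι} {F : ι → (Fin n → ℝ) → V}
    (hF : ∀ i ∈ s, VSmooth U (F i)) (hz : z ∈ U) :
    vpd A (fun w => ∑ i ∈ s, F i w) z = ∑ i ∈ s, vpd A (F i) z :=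
  (eq_vpd hU (VSmooth.sum hF) hz fun φ => by
    simp only [map_sum]
    rw [pd_sum _ fun i hi => (hF i hi φ).differentiableAt hU hz]
    exact Finset.sum_congr rfl fun i hi => dual_vpd hU (hF i hi) hz φ).symm

theorem vpd_smul (hU : IsOpen U) {f : (Fin n → ℝ) → ℝ} {F : (Fin n → ℝ) → V}
    (hf : Smooth U f) (hF : VSmooth U F) (hz : z ∈ U) :
    vpd A (fun w => f w • F w) z = pd A f z • F z + f z • vpd A F z :=
  (eq_vpd hU (hF.smul hf) hz fun φ => by
    simp only [map_add, map_smul, smul_eq_mul]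
    rw [pd_mul (hf.differentiableAt hU hz) ((hF φ).differentiableAt hU hz),
      dual_vpd hU hF hz]).symm

theorem vpd_smul_const (hU : IsOpen U) {f : (Fin n → ℝ) → ℝ} (hf : Smooth U f) (v : V)
    (hz : z ∈ U) : vpd A (fun w => f w • v) z = pd A f z • v := by
  rw [vpd_smul hU hf (VSmooth.const v) hz, vpd_const hU hz, smul_zero, add_zero]

end VectorCalculus

section AlgebraCalculus

variable {n : ℕ} {U : Set (Fin n → ℝ)} {A : Fin n} {z : Fin n → ℝ}
variable {C : Type*} [Ring C] [Algebra ℝ C] [Module.Finite ℝ C]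

theorem dual_mul_eq_sum_coord (φ : Dual ℝ C) (x y : C) :
    φ (x * y) = ∑ i, (finBasis ℝ C).coord i y *
      (φ ∘ₗ LinearMap.mulRight ℝ (finBasis ℝ C i)) x := by
  have := dual_eq_sum_coord (φ ∘ₗ LinearMap.mulLeft ℝ x) y
  simpa using this

theorem VSmooth.mul {F G : (Fin n → ℝ) → C} (hF : VSmooth U F) (hG : VSmooth U G) :
    VSmooth U (fun w => F w * G w) := fun φ => by
  simp only [dual_mul_eq_sum_coord]
  exact ContDiffOn.sum fun i _ => ContDiffOn.mul (hG _) (hF _)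

theorem vpd_mul (hU : IsOpen U) {F G : (Fin n → ℝ) → C} (hF : VSmooth U F) (hG : VSmooth U G)
    (hz : z ∈ U) : vpd A (fun w => F w * G w) z = vpd A F z * G z + F z * vpd A G z :=
  (eq_vpd hU (hF.mul hG) hz fun φ => by
    rw [map_add]
    simp only [dual_mul_eq_sum_coord φ]
    rw [pd_sum _ fun i _ => ((hG _).differentiableAt hU hz).fun_mul ((hF _).differentiableAt hU hz),
      ← Finset.sum_add_distrib]
    refine Finset.sum_congr rfl fun i _ => ?_
    rw [pd_mul ((hG _).differentiableAt hU hz) ((hF _).differentiableAt hU hz),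
      dual_vpd hU hF hz, dual_vpd hU hG hz]
    ring).symm

end AlgebraCalculus

section CliffordRelations

variable {n : ℕ} {C : Type*} [Ring C] [Algebra ℝ C]
variable {lam : ℝ} {γ : Fin n → C}

/-- The Clifford relations for the form `λ‖x‖²` in an orthonormal frame. -/
def IsClifford (lam : ℝ) (γ : Fin n → C) : Prop :=
  ∀ a b, γ a * γ b + γ b * γ a = (if a = b then 2 * lam else 0) • (1 : C)

/-- The quadratic expression `Σ M_{bc} γ_b γ_c`. -/
def quad (γ : Fin n → C) (M : Matrix (Fin n) (Fin n) ℝ) : C :=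
  ∑ b, ∑ c, M b c • (γ b * γ c)

theorem quad_add (M N : Matrix (Fin n) (Fin n) ℝ) : quad γ (M + N) = quad γ M + quad γ N := by
  simp [quad, add_smul, Finset.sum_add_distrib]

theorem quad_sub (M N : Matrix (Fin n) (Fin n) ℝ) : quad γ (M - N) = quad γ M - quad γ N := by
  simp [quad, sub_smul, Finset.sum_sub_distrib]

theorem IsClifford.mul_swap (h : IsClifford lam γ) (a b : Fin n) :
    γ a * γ b = (if a = b then 2 * lam else 0) • (1 : C) - γ b * γ a :=
  eq_sub_of_add_eq (h a b)

theorem IsClifford.mul_mul_sub (h : IsClifford lam γ) (b c d : Fin n) :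
    γ b * γ c * γ d - γ d * (γ b * γ c)
      = (if c = d then 2 * lam else 0) • γ b - (if d = b then 2 * lam else 0) • γ c := by
  rw [mul_assoc, h.mul_swap c d, ← mul_assoc (γ d), h.mul_swap d b]
  simp only [mul_sub, sub_mul, mul_smul_comm, smul_mul_assoc, mul_one, one_mul, mul_assoc]
  abel

theorem IsClifford.quad_commutator (h : IsClifford lam γ) {M : Matrix (Fin n) (Fin n) ℝ}
    (hM : ∀ b c, M c b = -M b c) (d : Fin n) :
    quad γ M * γ d - γ d * quad γ M = (4 * lam) • ∑ b, M b d • γ b := by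
  have : quad γ M * γ d - γ d * quad γ M
      = ∑ b, ∑ c, M b c • (γ b * γ c * γ d - γ d * (γ b * γ c)) := by
    simp only [quad, Finset.sum_mul, Finset.mul_sum, smul_mul_assoc, mul_smul_comm, smul_sub,
      Finset.sum_sub_distrib]
  simp only [this, h.mul_mul_sub, smul_sub, Finset.sum_sub_distrib, ite_smul, zero_smul, smul_ite,
    smul_zero, Finset.sum_ite_eq', Finset.mem_univ, if_true]
  rw [Finset.sum_comm (γ := Fin n)]
  simp only [Finset.sum_ite_eq, Finset.mem_univ, if_true]
  rw [Finset.smul_sum, ← Finset.sum_sub_distrib]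
  refine Finset.sum_congr rfl fun b _ => ?_
  rw [hM b d]
  module

theorem IsClifford.quad_mul_quad_sub (h : IsClifford lam γ) {M N : Matrix (Fin n) (Fin n) ℝ}
    (hM : ∀ b c, M c b = -M b c) :
    quad γ M * quad γ N - quad γ N * quad γ M = (4 * lam) • quad γ (M * N - N * M) := by
  have h1 : quad γ M * quad γ N - quad γ N * quad γ M
      = ∑ b, ∑ c, N b c • ((quad γ M * γ b - γ b * quad γ M) * γ c
          + γ b * (quad γ M * γ c - γ c * quad γ M)) := by
    conv_lhs => rw [quad.eq_def γ N]
    simp only [Finset.sum_mul, Finset.mul_sum, smul_mul_assoc, mul_smul_comm, mul_sub, sub_mul,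
      ← Finset.sum_sub_distrib, ← smul_sub, mul_assoc]
    refine Finset.sum_congr rfl fun b _ => Finset.sum_congr rfl fun c _ => ?_
    congr 1
    abel
  have h2 : quad γ (M * N) = ∑ b, ∑ c, N b c • ((∑ d, M d b • γ d) * γ c) := by
    simp only [quad, Matrix.mul_apply, Finset.sum_smul, Finset.sum_mul, Finset.smul_sum,
      smul_mul_assoc, smul_smul]
    rw [Finset.sum_congr rfl fun b _ => Finset.sum_comm, Finset.sum_comm]
    refine Finset.sum_congr rfl fun b _ => ?_
    rw [Finset.sum_comm]
    simp only [mul_comm]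
  have h3 : quad γ (N * M) = -∑ b, ∑ c, N b c • (γ b * ∑ d, M d c • γ d) := by
    simp only [quad, Matrix.mul_apply, Finset.sum_smul, Finset.mul_sum, Finset.smul_sum,
      mul_smul_comm, smul_smul, ← Finset.sum_neg_distrib]
    refine Finset.sum_congr rfl fun b _ => ?_
    rw [Finset.sum_comm]
    refine Finset.sum_congr rfl fun c _ => Finset.sum_congr rfl fun d _ => ?_
    rw [hM c d, ← neg_smul]
    congr 1
    ring
  rw [h1, quad_sub, h2, h3, sub_neg_eq_add, ← Finset.sum_add_distrib, Finset.smul_sum]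
  refine Finset.sum_congr rfl fun b _ => ?_
  rw [← Finset.sum_add_distrib, Finset.smul_sum]
  refine Finset.sum_congr rfl fun c _ => ?_
  rw [h.quad_commutator hM, h.quad_commutator hM]
  simp only [smul_mul_assoc, mul_smul_comm]
  module

/-- A tensor with the antisymmetries of a Riemann tensor and the first Bianchi identity is
symmetric under exchange of index pairs. -/
theorem pair_symm {T : Fin n → Fin n → Fin n → Fin n → ℝ} (hab : ∀ d a b c, T d b a c = -T d a b c)
    (hdc : ∀ d a b c, T c a b d = -T d a b c)
    (hcyc : ∀ d a b c, T d a b c + T d b c a + T d c a b = 0) (d a b c : Fin n) :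
    T d a b c = T a d c b := by
  linarith [hcyc d a b c, hcyc a d b c, hcyc b d a c, hcyc c d a b,
    hab d a b c, hab d b c a, hab d c a b, hab a d b c, hab a b c d, hab a c d b,
    hab b d a c, hab b a c d, hab b c d a, hab c d a b, hab c a b d, hab c b d a,
    hdc d a b c, hdc d b c a, hdc d c a b, hdc a d b c, hdc a b c d, hdc a c d b,
    hdc b d a c, hdc b a c d, hdc b c d a, hdc c d a b, hdc c a b d, hdc c b d a,
    hdc d b a c, hdc d c b a, hdc d a c b, hdc a b d c, hdc a c b d, hdc a d c b,
    hdc b a d c, hdc b c a d, hdc b d c a, hdc c a d b, hdc c b a d, hdc c d b a]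

theorem sum_cycle {M : Type*} [AddCommMonoid M] (f : Fin n → Fin n → Fin n → M) :
    ∑ a, ∑ b, ∑ c, f b c a = ∑ a, ∑ b, ∑ c, f a b c := by
  rw [Finset.sum_comm]
  exact Finset.sum_congr rfl fun b _ => Finset.sum_comm

theorem sum_comm_pair {M : Type*} [AddCommMonoid M] (f : Fin n → Fin n → Fin n → Fin n → M) :
    ∑ A, ∑ B, ∑ a, ∑ b, f A B a b = ∑ a, ∑ b, ∑ A, ∑ B, f A B a b := by
  have := Finset.sum_comm (s := Finset.univ) (t := Finset.univ)
    (f := fun x y : Fin n × Fin n => f x.1 x.2 y.1 y.2)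
  simpa only [Fintype.sum_prod_type] using this

theorem IsClifford.sum_cyclic_mul (h : IsClifford lam γ) (a b c : Fin n) :
    γ a * γ b * γ c + γ c * γ a * γ b + γ b * γ c * γ a
      = (3 : ℝ) • (γ a * γ b * γ c) + (2 : ℝ) • (if a = c then 2 * lam else 0) • γ b
        - (if b = c then 2 * lam else 0) • γ a - (if a = b then 2 * lam else 0) • γ c := by
  have h1 := h.mul_mul_sub a b c
  have h2 := h.mul_mul_sub b c a
  rw [sub_eq_iff_eq_add] at h1 h2
  rw [h2, mul_assoc (γ c), mul_assoc (γ a), ← sub_eq_zero]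
  rw [mul_assoc (γ a)] at h1
  rw [h1]
  simp only [eq_comm (a := c) (b := a)]
  module

/-- Contraction of three gamma matrices with a Riemann-type tensor. -/
theorem IsClifford.sum_three (h : IsClifford lam γ) {T : Fin n → Fin n → Fin n → ℝ}
    (hab : ∀ a b c, T b a c = -T a b c) (hcyc : ∀ a b c, T a b c + T b c a + T c a b = 0) :
    ∑ a, ∑ b, ∑ c, T a b c • (γ a * γ b * γ c)
      = (-2 * lam) • ∑ b, (∑ a, T a b a) • γ b := by
  set P := ∑ a, ∑ b, ∑ c, T a b c • (γ a * γ b * γ c) with hP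
  have haa : ∀ a c, T a a c = 0 := fun a c => by linarith [hab a a c]
  have e1 : ∑ a, ∑ b, ∑ c, T a b c • (γ a * γ b * γ c + γ c * γ a * γ b + γ b * γ c * γ a) = 0 := by
    simp only [smul_add, Finset.sum_add_distrib]
    rw [← sum_cycle fun a b c => T a b c • (γ c * γ a * γ b),
      ← sum_cycle fun a b c => T a b c • (γ b * γ c * γ a),
      ← sum_cycle fun a b c => T b c a • (γ c * γ a * γ b)]
    simp only [← Finset.sum_add_distrib, ← add_smul, hcyc, zero_smul, Finset.sum_const_zero]
  have e2 : ∑ a, ∑ b, T a b b • γ a = -∑ b, (∑ a, T a b a) • γ b := by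
    simp only [Finset.sum_smul, ← Finset.sum_neg_distrib, ← neg_smul, ← hab]
  have e3 : (3 : ℝ) • P + (4 * lam) • (∑ b, (∑ a, T a b a) • γ b)
      - (2 * lam) • (∑ a, ∑ b, T a b b • γ a) = 0 := by
    rw [← e1, hP]
    simp only [h.sum_cyclic_mul, smul_sub, smul_add, Finset.sum_sub_distrib,
      Finset.sum_add_distrib, ite_smul, smul_ite, zero_smul, smul_zero, Finset.sum_ite_eq,
      Finset.mem_univ, if_true]
    have z : ∑ a, ∑ b, ∑ c, (if a = b then T a b c • (2 * lam) • γ c else 0) = 0 := by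
      refine Finset.sum_eq_zero fun a _ => Finset.sum_eq_zero fun b _ =>
        Finset.sum_eq_zero fun c _ => ?_
      split_ifs with hh
      · rw [hh, haa, zero_smul]
      · rfl
    rw [z, sub_zero]
    congr 1
    · congr 1
      · simp only [Finset.smul_sum, smul_comm (3 : ℝ)]
      · rw [Finset.sum_comm]
        simp only [Finset.sum_smul, Finset.smul_sum]
        refine Finset.sum_congr rfl fun a _ => Finset.sum_congr rfl fun b _ => ?_
        module
    · simp only [Finset.smul_sum, smul_comm (2 * lam)]
  rw [e2] at e3
  have e4 : (3 : ℝ) • (P - (-2 * lam) • ∑ b, (∑ a, T a b a) • γ b) = 0 := by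
    rw [← e3]
    module
  exact sub_eq_zero.mp ((smul_eq_zero_iff_right (by norm_num)).mp e4)

/-- Contraction of four gamma matrices with a Riemann-type tensor. -/
theorem IsClifford.sum_four (h : IsClifford lam γ) {T : Fin n → Fin n → Fin n → Fin n → ℝ}
    (hab : ∀ d a b c, T d b a c = -T d a b c) (hdc : ∀ d a b c, T c a b d = -T d a b c)
    (hcyc : ∀ d a b c, T d a b c + T d b c a + T d c a b = 0) :
    ∑ d, ∑ a, ∑ b, ∑ c, T d a b c • (γ a * γ b * (γ d * γ c))
      = (-2 * lam ^ 2 * ∑ d, ∑ a, T d d a a) • (1 : C) := by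
  have hdd : ∀ d a b, T d a b d = 0 := fun d a b => by linarith [hdc d a b d]
  have e1 : ∀ d, ∑ a, ∑ b, ∑ c, T d a b c • (γ a * γ b * (γ d * γ c))
      = (2 * lam) • ∑ b, (∑ a, T d a b a) • (γ b * γ d) := by
    intro d
    have : ∀ a b c, T d a b c • (γ a * γ b * (γ d * γ c))
        = -(T d a b c • (γ a * γ b * γ c)) * γ d := by
      intro a b c
      rw [h.mul_swap d c]
      split_ifs with hh
      · simp [← hh, hdd]
      · simp [mul_assoc]
    simp only [this, ← Finset.sum_mul, Finset.sum_neg_distrib]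
    rw [h.sum_three (hab d) (hcyc d)]
    simp only [Finset.smul_sum, ← Finset.sum_neg_distrib, Finset.sum_mul, neg_mul, smul_mul_assoc,
      neg_smul, neg_neg]
  have hS : ∀ d b, ∑ a, T d a b a = ∑ a, T b a d a := by
    intro d b
    refine Finset.sum_congr rfl fun a _ => ?_
    rw [pair_symm hab hdc hcyc d a b a, hab a a d b, ← hdc a a d b]
  have e2 : ∑ d, ∑ b, (∑ a, T d a b a) • (γ b * γ d) = (lam * ∑ d, ∑ a, T d a d a) • (1 : C) := by
    have e3 : (2 : ℝ) • ∑ d, ∑ b, (∑ a, T d a b a) • (γ b * γ d)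
        = ∑ d, ∑ b, (∑ a, T d a b a) • (γ b * γ d + γ d * γ b) := by
      rw [two_smul]
      simp only [smul_add, Finset.sum_add_distrib]
      congr 1
      rw [Finset.sum_comm]
      refine Finset.sum_congr rfl fun d _ => Finset.sum_congr rfl fun b _ => ?_
      rw [hS]
    have e4 : (2 : ℝ) • ∑ d, ∑ b, (∑ a, T d a b a) • (γ b * γ d)
        = (2 : ℝ) • (lam * ∑ d, ∑ a, T d a d a) • (1 : C) := by
      rw [e3]
      simp only [h _ _, ite_smul, zero_smul, smul_ite, smul_zero, Finset.sum_ite_eq',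
        Finset.mem_univ, if_true, smul_smul, ← Finset.sum_smul, ← Finset.sum_mul]
      congr 1
      ring
    exact (smul_right_injective C (two_ne_zero (α := ℝ))) e4
  simp only [e1]
  rw [← Finset.smul_sum, e2, smul_smul]
  congr 1
  have : ∑ d, ∑ a, T d a d a = -∑ d, ∑ a, T d d a a := by
    simp only [← Finset.sum_neg_distrib, ← hab]
  rw [this]
  ring

end CliffordRelations

section MatrixCalculus

open Matrix

variable {n : ℕ} {U : Set (Fin n → ℝ)} {A B : Fin n} {z : Fin n → ℝ}
variable {M N : (Fin n → ℝ) → Matrix (Fin n) (Fin n) ℝ}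

/-- Entrywise smoothness of a matrix-valued function. -/
def MSmooth (U : Set (Fin n → ℝ)) (M : (Fin n → ℝ) → Matrix (Fin n) (Fin n) ℝ) : Prop :=
  ∀ i j, Smooth U (fun w => M w i j)

/-- The entrywise `A`-th partial derivative of a matrix-valued function. -/
noncomputable def mpd (A : Fin n) (M : (Fin n → ℝ) → Matrix (Fin n) (Fin n) ℝ)
    (z : Fin n → ℝ) : Matrix (Fin n) (Fin n) ℝ :=
  of fun i j => pd A (fun w => M w i j) z

theorem MSmooth.congr (hM : MSmooth U M) (h : ∀ w ∈ U, N w = M w) : MSmooth U N :=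
  fun i j => (hM i j).congr fun w hw => by rw [h w hw]

theorem MSmooth.mul (hM : MSmooth U M) (hN : MSmooth U N) : MSmooth U (fun w => M w * N w) :=
  fun i j => by
  simp only [mul_apply]
  exact ContDiffOn.sum fun k _ => ContDiffOn.mul (hM i k) (hN k j)

theorem MSmooth.sub (hM : MSmooth U M) (hN : MSmooth U N) : MSmooth U (fun w => M w - N w) :=
  fun i j => ContDiffOn.sub (hM i j) (hN i j)

theorem MSmooth.transpose (hM : MSmooth U M) : MSmooth U (fun w => (M w)ᵀ) :=
  fun i j => hM j i

theorem MSmooth.partialDeriv (hU : IsOpen U) (hM : MSmooth U M) : MSmooth U (mpd A M) :=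
  fun i j => Smooth.partialDeriv (hM i j) hU

theorem MSmooth.det (hM : MSmooth U M) : Smooth U (fun w => (M w).det) := by
  simp only [det_apply']
  exact ContDiffOn.sum fun σ _ => contDiffOn_const.mul (contDiffOn_prod fun i _ => hM _ _)

theorem MSmooth.adjugate (hM : MSmooth U M) : MSmooth U (fun w => (M w).adjugate) := by
  intro i j
  simp only [adjugate_apply]
  refine MSmooth.det fun k l => ?_
  by_cases h : k = j
  · subst h
    simp only [updateRow_self]
    exact contDiffOn_const
  · simp only [updateRow_ne h]
    exact hM k l

theorem MSmooth.of_mul_eq_one (hM : MSmooth U M) (h : ∀ w ∈ U, M w * N w = 1) : MSmooth U N := by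
  have hdet : ∀ w ∈ U, (M w).det ≠ 0 := fun w hw h0 => by
    have := congrArg Matrix.det (h w hw)
    rw [det_mul, h0, zero_mul, det_one] at this
    exact zero_ne_one this
  intro i j
  refine (ContDiffOn.mul (hM.det.inv hdet) (hM.adjugate i j)).congr fun w hw => ?_
  rw [← inv_eq_right_inv (h w hw), inv_def, Matrix.smul_apply, Ring.inverse_eq_inv', smul_eq_mul]
  rfl

theorem mpd_congr (hU : IsOpen U) (hz : z ∈ U) (h : ∀ w ∈ U, M w = N w) :
    mpd A M z = mpd A N z := by
  ext i j
  exact pd_congr hU hz fun w hw => by rw [h w hw]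

theorem mpd_const (X : Matrix (Fin n) (Fin n) ℝ) : mpd A (fun _ => X) z = 0 := by
  ext i j
  exact pd_const _

theorem mpd_sub (hU : IsOpen U) (hM : MSmooth U M) (hN : MSmooth U N) (hz : z ∈ U) :
    mpd A (fun w => M w - N w) z = mpd A M z - mpd A N z := by
  ext i j
  exact pd_sub ((hM i j).differentiableAt hU hz) ((hN i j).differentiableAt hU hz)

theorem mpd_mul (hU : IsOpen U) (hM : MSmooth U M) (hN : MSmooth U N) (hz : z ∈ U) :
    mpd A (fun w => M w * N w) z = mpd A M z * N z + M z * mpd A N z := by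
  ext i j
  simp only [mpd, of_apply, mul_apply, Matrix.add_apply]
  rw [pd_sum _ fun k _ => ((hM i k).differentiableAt hU hz).fun_mul
    ((hN k j).differentiableAt hU hz), ← Finset.sum_add_distrib]
  exact Finset.sum_congr rfl fun k _ =>
    pd_mul ((hM i k).differentiableAt hU hz) ((hN k j).differentiableAt hU hz)

theorem mpd_comm (hU : IsOpen U) (hM : MSmooth U M) (hz : z ∈ U) :
    mpd A (mpd B M) z = mpd B (mpd A M) z := by
  ext i j
  exact pd_comm hU (hM i j) hz

theorem pd_prod (hU : IsOpen U) (hz : z ∈ U) {ι : Type*} [DecidableEq ι] (s : Finset ι)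
    {F : ι → (Fin n → ℝ) → ℝ} (hF : ∀ i, Smooth U (F i)) :
    pd A (fun w => ∏ i ∈ s, F i w) z
      = ∑ i ∈ s, ∏ j ∈ s, if j = i then pd A (F i) z else F j z := by
  induction s using Finset.induction_on with
  | empty => simp [pd_const]
  | insert k s hk ih =>
    simp only [Finset.prod_insert hk]
    rw [pd_mul ((hF k).differentiableAt hU hz) (Smooth.differentiableAt (U := U)
      (contDiffOn_prod fun i _ => hF i) hU hz), ih, Finset.sum_insert hk, Finset.mul_sum]
    congr 1
    · rw [if_pos rfl]
      congr 1
      refine Finset.prod_congr rfl fun j hj => ?_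
      rw [if_neg]
      rintro rfl
      exact hk hj
    · refine Finset.sum_congr rfl fun i hi => ?_
      rw [if_neg]
      rintro rfl
      exact hk hi

/-- Jacobi's formula for the derivative of a determinant. -/
theorem pd_det (hU : IsOpen U) (hM : MSmooth U M) (hz : z ∈ U) :
    pd A (fun w => (M w).det) z = ((M z).adjugate * mpd A M z).trace := by
  have h : ∀ i, ((M z).adjugate * mpd A M z) i i
      = ((M z).updateCol i fun j => mpd A M z j i).det := by
    intro i
    rw [← cramer_apply, cramer_eq_adjugate_mulVec]
    rfl
  have hprod : ∀ σ : Equiv.Perm (Fin n), Smooth U fun w => ∏ i, M w (σ i) i :=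
    fun σ => contDiffOn_prod fun i _ => hM _ _
  simp only [trace, diag_apply, h, det_apply']
  rw [pd_sum _ fun σ _ => (differentiableAt_const _).fun_mul ((hprod σ).differentiableAt hU hz),
    Finset.sum_comm]
  refine Finset.sum_congr rfl fun σ _ => ?_
  rw [pd_mul (differentiableAt_const _) ((hprod σ).differentiableAt hU hz), pd_const, zero_mul,
    zero_add, pd_prod hU hz _ fun i => hM (σ i) i, Finset.mul_sum]
  refine Finset.sum_congr rfl fun i _ => ?_
  congr 1
  refine Finset.prod_congr rfl fun j _ => ?_
  rw [updateCol_apply]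
  split_ifs with hj
  · rw [hj]; rfl
  · rfl

end MatrixCalculus

section Vielbein

open Matrix

variable {n : ℕ} {U : Set (Fin n → ℝ)} {e eInv gup : (Fin n → ℝ) → Fin n → Fin n → ℝ}
variable {z : Fin n → ℝ}

/-- A smooth vielbein `e` on an open set `U` with pointwise inverse `eInv` and inverse induced
metric `gup`. -/
structure IsVielbein (U : Set (Fin n → ℝ)) (e eInv gup : (Fin n → ℝ) → Fin n → Fin n → ℝ) :
    Prop where
  isOpen : IsOpen U
  smooth : MSmooth U fun w => of (e w)
  mul_inv : ∀ w ∈ U, of (e w) * of (eInv w) = 1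
  inv_mul : ∀ w ∈ U, of (eInv w) * of (e w) = 1
  metric : ∀ w ∈ U, of (glowE e w) * of (gup w) = 1

/-- The Christoffel symbols `Γ^D{}_{AC}` as a matrix in `D`, `C`. -/
noncomputable def chM (e gup : (Fin n → ℝ) → Fin n → Fin n → ℝ) (A : Fin n) (w : Fin n → ℝ) :
    Matrix (Fin n) (Fin n) ℝ :=
  of fun D C => christ gup (glowE e) D A C w

/-- The spin connection `ω^b{}_{Ac}` as a matrix in `b`, `c`. -/
noncomputable def spM (e eInv gup : (Fin n → ℝ) → Fin n → Fin n → ℝ) (A : Fin n)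
    (w : Fin n → ℝ) : Matrix (Fin n) (Fin n) ℝ :=
  of fun b c => spinConnE e eInv gup b A c w

/-- The Riemann tensor `R^D{}_{ABC}` as a matrix in `D`, `C`. -/
noncomputable def riemM (e gup : (Fin n → ℝ) → Fin n → Fin n → ℝ) (A B : Fin n)
    (w : Fin n → ℝ) : Matrix (Fin n) (Fin n) ℝ :=
  of fun D C => riem gup (glowE e) D A B C w

/-- The curvature of the spin connection. -/
noncomputable def spinCurv (e eInv gup : (Fin n → ℝ) → Fin n → Fin n → ℝ) (A B : Fin n)
    (w : Fin n → ℝ) : Matrix (Fin n) (Fin n) ℝ :=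
  mpd A (spM e eInv gup B) w - mpd B (spM e eInv gup A) w
    + (spM e eInv gup A w * spM e eInv gup B w - spM e eInv gup B w * spM e eInv gup A w)

theorem of_glowE (w : Fin n → ℝ) : of (glowE e w) = (of (e w))ᵀ * of (e w) := by
  ext i j
  simp [glowE, mul_apply]

theorem glowE_symm (w : Fin n → ℝ) (A B : Fin n) : glowE e w A B = glowE e w B A := by
  simp only [glowE, mul_comm]

theorem christ_symm (D A B : Fin n) :
    christ gup (glowE e) D A B = christ gup (glowE e) D B A := by
  funext w
  refine Finset.sum_congr rfl fun C _ => ?_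
  have : (fun u => glowE e u A B) = fun u => glowE e u B A := funext fun u => glowE_symm u A B
  rw [christLow, christLow, this]
  ring

theorem chM_symm (w : Fin n → ℝ) (D A B : Fin n) : chM e gup A w D B = chM e gup B w D A := by
  simp only [chM, of_apply, christ_symm D A B]

theorem spM_eq (A : Fin n) (w : Fin n → ℝ) :
    spM e eInv gup A w = of (e w) * chM e gup A w * of (eInv w)
      - mpd A (fun u => of (e u)) w * of (eInv w) := by
  ext b c
  simp only [spM, spinConnE, chM, mpd, of_apply, mul_apply, Matrix.sub_apply, Finset.sum_mul]
  rw [Finset.sum_comm]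

theorem riemM_eq (A B : Fin n) (w : Fin n → ℝ) :
    riemM e gup A B w = mpd A (chM e gup B) w - mpd B (chM e gup A) w
      + (chM e gup A w * chM e gup B w - chM e gup B w * chM e gup A w) := by
  ext D C
  simp only [riemM, riem, chM, mpd, of_apply, mul_apply, Matrix.sub_apply, Matrix.add_apply,
    Finset.sum_sub_distrib]

theorem riemM_cyclic (D A B C : Fin n) (w : Fin n → ℝ) :
    riemM e gup A B w D C + riemM e gup B C w D A + riemM e gup C A w D B = 0 := by
  simp only [riemM, riem, of_apply, Finset.sum_sub_distrib, christ_symm _ B A, christ_symm _ C A, christ_symm _ C B]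
  ring

theorem spinCurv_swap (A B : Fin n) : spinCurv e eInv gup B A z = -spinCurv e eInv gup A B z := by
  simp only [spinCurv]
  abel

namespace IsVielbein

theorem smooth_inv (h : IsVielbein U e eInv gup) : MSmooth U fun w => of (eInv w) :=
  h.smooth.of_mul_eq_one h.mul_inv

theorem gup_eq (h : IsVielbein U e eInv gup) (hz : z ∈ U) :
    of (gup z) = of (eInv z) * (of (eInv z))ᵀ := by
  have h1 : of (eInv z) * (of (eInv z))ᵀ * of (glowE e z) = 1 := by
    rw [of_glowE, Matrix.mul_assoc, ← Matrix.mul_assoc (of (eInv z))ᵀ, ← transpose_mul,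
      h.mul_inv z hz, transpose_one, Matrix.one_mul, h.inv_mul z hz]
  rw [← Matrix.mul_one (_ * _), ← h.metric z hz, ← Matrix.mul_assoc, h1, Matrix.one_mul]

theorem smooth_gup (h : IsVielbein U e eInv gup) : MSmooth U fun w => of (gup w) :=
  (h.smooth_inv.mul h.smooth_inv.transpose).congr fun _ hw => h.gup_eq hw

theorem smooth_glowE (h : IsVielbein U e eInv gup) : MSmooth U fun w => of (glowE e w) :=
  (h.smooth.transpose.mul h.smooth).congr fun w _ => of_glowE w

theorem smooth_chM (h : IsVielbein U e eInv gup) (A : Fin n) : MSmooth U (chM e gup A) := by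
  intro D C
  have hg : ∀ K A B, Smooth U (pd K fun u => glowE e u A B) := fun K A B =>
    Smooth.partialDeriv (h.smooth_glowE A B) h.isOpen
  have hc : (fun w => chM e gup A w D C)
      = fun w => ∑ K, gup w D K * christLow (glowE e) K A C w := rfl
  rw [hc]
  refine ContDiffOn.sum fun K _ => ContDiffOn.mul (h.smooth_gup D K) ?_
  exact (((hg _ _ _).add (hg _ _ _)).sub (hg _ _ _)).div_const 2

theorem smooth_spM (h : IsVielbein U e eInv gup) (A : Fin n) : MSmooth U (spM e eInv gup A) :=
  (((h.smooth.mul (h.smooth_chM A)).mul h.smooth_inv).sub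
    ((h.smooth.partialDeriv h.isOpen).mul h.smooth_inv)).congr fun w _ => spM_eq A w

/-- Covariant constancy of the vielbein. -/
theorem mpd_vielbein (h : IsVielbein U e eInv gup) (A : Fin n) (hz : z ∈ U) :
    mpd A (fun w => of (e w)) z
      = of (e z) * chM e gup A z - spM e eInv gup A z * of (e z) := by
  rw [spM_eq, Matrix.sub_mul, Matrix.mul_assoc _ (of (eInv z)), Matrix.mul_assoc _ (of (eInv z)),
    h.inv_mul z hz, Matrix.mul_one, Matrix.mul_one, sub_sub_cancel]

/-- Covariant constancy of the inverse vielbein. -/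
theorem mpd_inv (h : IsVielbein U e eInv gup) (A : Fin n) (hz : z ∈ U) :
    mpd A (fun w => of (eInv w)) z
      = of (eInv z) * spM e eInv gup A z - chM e gup A z * of (eInv z) := by
  have h1 : mpd A (fun w => of (eInv w) * of (e w)) z = 0 := by
    rw [mpd_congr h.isOpen hz h.inv_mul, mpd_const]
  rw [mpd_mul h.isOpen h.smooth_inv h.smooth hz, h.mpd_vielbein A hz, Matrix.mul_sub,
    ← Matrix.mul_assoc, h.inv_mul z hz, Matrix.one_mul] at h1
  have h2 := congrArg (· * of (eInv z)) h1
  simp only [Matrix.add_mul, Matrix.sub_mul, Matrix.mul_assoc, h.mul_inv z hz, Matrix.mul_one,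
    Matrix.zero_mul] at h2
  rw [eq_comm, ← sub_eq_zero, ← neg_eq_zero, ← h2]
  abel

/-- Metric compatibility: the spin connection is antisymmetric. -/
theorem spM_transpose (h : IsVielbein U e eInv gup) (A : Fin n) (hz : z ∈ U) :
    (spM e eInv gup A z)ᵀ = -spM e eInv gup A z := by
  set L : Matrix (Fin n) (Fin n) ℝ := of fun D C => christLow (glowE e) D A C z with hL
  have hlow : of (glowE e z) * chM e gup A z = L := by
    have : chM e gup A z = of (gup z) * L := by
      ext D C
      simp [chM, christ, mul_apply, hL]
    rw [this, ← Matrix.mul_assoc, h.metric z hz, Matrix.one_mul]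
  have hLL : L + Lᵀ = mpd A (fun w => of (glowE e w)) z := by
    ext D C
    have s : ∀ K L, (fun u => glowE e u K L) = fun u => glowE e u L K := fun K L =>
      funext fun u => glowE_symm u K L
    simp only [hL, christLow, mpd, Matrix.add_apply, transpose_apply, of_apply, s C D, s C A, s A D]
    ring
  have hG : mpd A (fun w => of (glowE e w)) z
      = (mpd A (fun w => of (e w)) z)ᵀ * of (e z) + (of (e z))ᵀ * mpd A (fun w => of (e w)) z := by
    rw [mpd_congr h.isOpen hz fun w _ => of_glowE w,
      mpd_mul h.isOpen h.smooth.transpose h.smooth hz]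
    rfl
  rw [hG, h.mpd_vielbein A hz, ← hlow, of_glowE] at hLL
  simp only [transpose_sub, transpose_mul, transpose_transpose, Matrix.mul_sub, Matrix.sub_mul,
    Matrix.mul_assoc] at hLL
  have h1 : (of (e z))ᵀ * ((spM e eInv gup A z)ᵀ + spM e eInv gup A z) * of (e z) = 0 := by
    rw [Matrix.mul_add, Matrix.add_mul, Matrix.mul_assoc, Matrix.mul_assoc]
    rw [← sub_eq_zero] at hLL
    rw [← hLL]
    abel
  have h2 := congrArg (fun X => (of (eInv z))ᵀ * X * of (eInv z)) h1
  simp only [Matrix.mul_assoc, h.mul_inv z hz, Matrix.mul_one, Matrix.mul_zero,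
    Matrix.zero_mul] at h2
  rw [← Matrix.mul_assoc, ← transpose_mul, h.mul_inv z hz, transpose_one, Matrix.one_mul] at h2
  exact eq_neg_of_add_eq_zero_left h2

theorem spM_antisymm (h : IsVielbein U e eInv gup) (A : Fin n) (hz : z ∈ U) (b c : Fin n) :
    spM e eInv gup A z c b = -spM e eInv gup A z b c :=
  congrFun (congrFun (h.spM_transpose A hz) b) c

theorem pd_rhoE (h : IsVielbein U e eInv gup) (A : Fin n) (hz : z ∈ U) :
    pd A (rhoE e) z = rhoE e z * (chM e gup A z).trace := by
  have hadj : (of (e z)).adjugate = rhoE e z • of (eInv z) := by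
    have := congrArg (· * of (eInv z)) (adjugate_mul (of (e z)))
    simp only [Matrix.mul_assoc, h.mul_inv z hz, Matrix.mul_one, Matrix.smul_mul,
      Matrix.one_mul] at this
    exact this
  have htr : (spM e eInv gup A z).trace = 0 := by
    have := congrArg Matrix.trace (h.spM_transpose A hz)
    rw [trace_transpose, trace_neg] at this
    linarith
  have h1 : pd A (rhoE e) z = _ := pd_det h.isOpen h.smooth hz
  rw [h1, hadj, Matrix.smul_mul, trace_smul, smul_eq_mul, h.mpd_vielbein A hz, Matrix.mul_sub,
    ← Matrix.mul_assoc, h.inv_mul z hz, Matrix.one_mul, trace_sub, trace_mul_comm (of (eInv z)),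
    Matrix.mul_assoc, h.mul_inv z hz, Matrix.mul_one, htr, sub_zero]

theorem mpd_gup (h : IsVielbein U e eInv gup) (A : Fin n) (hz : z ∈ U) :
    mpd A (fun w => of (gup w)) z
      = -(chM e gup A z * of (gup z)) - of (gup z) * (chM e gup A z)ᵀ := by
  have hT : mpd A (fun w => (of (eInv w))ᵀ) z = (mpd A (fun w => of (eInv w)) z)ᵀ := rfl
  rw [mpd_congr h.isOpen hz fun w hw => h.gup_eq hw,
    mpd_mul h.isOpen h.smooth_inv h.smooth_inv.transpose hz, hT, h.mpd_inv A hz, h.gup_eq hz,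
    transpose_sub, transpose_mul, transpose_mul, h.spM_transpose A hz]
  noncomm_ring

theorem smooth_rhoE (h : IsVielbein U e eInv gup) : Smooth U (rhoE e) := h.smooth.det

/-- The divergence of the densitized inverse metric. -/
theorem sum_pd_rhoE_mul_gup (h : IsVielbein U e eInv gup) (B : Fin n) (hz : z ∈ U) :
    ∑ A, pd A (fun w => rhoE e w * gup w A B) z
      = -(rhoE e z * ∑ A, ∑ C, gup z A C * chM e gup A z B C) := by
  have h1 : ∀ A, pd A (fun w => rhoE e w * gup w A B) z
      = rhoE e z * ∑ C, chM e gup A z C C * gup z A B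
        + rhoE e z * (-∑ C, chM e gup A z A C * gup z C B - ∑ C, gup z A C * chM e gup A z B C) := by
    intro A
    have h2 : pd A (fun w => gup w A B) z = _ := congrFun (congrFun (h.mpd_gup A hz) A) B
    have hd : DifferentiableAt ℝ (fun w => gup w A B) z :=
      Smooth.differentiableAt (h.smooth_gup A B) h.isOpen hz
    rw [pd_mul (h.smooth_rhoE.differentiableAt h.isOpen hz) hd, h2, h.pd_rhoE A hz]
    simp only [Matrix.sub_apply, Matrix.neg_apply, mul_apply, transpose_apply, of_apply, trace,
      diag_apply, Finset.sum_mul, Finset.mul_sum, mul_assoc]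
  have h3 : ∑ A, ∑ C, chM e gup A z C C * gup z A B = ∑ A, ∑ C, chM e gup A z A C * gup z C B := by
    rw [Finset.sum_comm]
    refine Finset.sum_congr rfl fun C _ => Finset.sum_congr rfl fun A _ => ?_
    rw [chM_symm]
  simp only [h1, Finset.sum_add_distrib, ← Finset.mul_sum, Finset.sum_sub_distrib,
    Finset.sum_neg_distrib, h3]
  ring

/-- The Cartan structure equation relating the curvature of the spin connection to the Riemann
tensor. -/
theorem spinCurv_eq (h : IsVielbein U e eInv gup) (A B : Fin n) (hz : z ∈ U) :
    spinCurv e eInv gup A B z = of (e z) * riemM e gup A B z * of (eInv z) := by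
  have key : ∀ A B, mpd A (mpd B fun w => of (e w)) z
      = (of (e z) * chM e gup A z - spM e eInv gup A z * of (e z)) * chM e gup B z
        + of (e z) * mpd A (chM e gup B) z
        - (mpd A (spM e eInv gup B) z * of (e z)
          + spM e eInv gup B z * (of (e z) * chM e gup A z - spM e eInv gup A z * of (e z))) := by
    intro A B
    rw [mpd_congr h.isOpen hz fun w hw => h.mpd_vielbein B hw,
      mpd_sub h.isOpen (h.smooth.mul (h.smooth_chM B)) ((h.smooth_spM B).mul h.smooth) hz,
      mpd_mul h.isOpen h.smooth (h.smooth_chM B) hz,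
      mpd_mul h.isOpen (h.smooth_spM B) h.smooth hz, h.mpd_vielbein A hz]
  have hc := mpd_comm (A := A) (B := B) h.isOpen h.smooth hz
  rw [key, key, ← sub_eq_zero] at hc
  have h1 : of (e z) * riemM e gup A B z = spinCurv e eInv gup A B z * of (e z) := by
    rw [← sub_eq_zero, ← hc, riemM_eq, spinCurv]
    noncomm_ring
  rw [h1, Matrix.mul_assoc, h.mul_inv z hz, Matrix.mul_one]

theorem spinCurv_antisymm (h : IsVielbein U e eInv gup) (A B : Fin n) (hz : z ∈ U) (b c : Fin n) :
    spinCurv e eInv gup A B z c b = -spinCurv e eInv gup A B z b c := by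
  have hT : ∀ A B, (mpd A (spM e eInv gup B) z)ᵀ = -mpd A (spM e eInv gup B) z := by
    intro A B
    have h1 : (mpd A (spM e eInv gup B) z)ᵀ = mpd A (fun w => (spM e eInv gup B w)ᵀ) z := rfl
    rw [h1, mpd_congr (N := fun w => 0 - spM e eInv gup B w) h.isOpen hz
      fun w hw => by rw [h.spM_transpose B hw, zero_sub],
      mpd_sub (M := fun _ => 0) h.isOpen (fun _ _ => contDiffOn_const) (h.smooth_spM B) hz,
      mpd_const, zero_sub]
  have h2 : (spinCurv e eInv gup A B z)ᵀ = -spinCurv e eInv gup A B z := by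
    simp only [spinCurv, transpose_add, transpose_sub, transpose_mul, hT, h.spM_transpose _ hz]
    noncomm_ring
  exact congrFun (congrFun h2 b) c

end IsVielbein

end Vielbein

section SpinorConnection

open Matrix

variable {n : ℕ} {U : Set (Fin n → ℝ)} {e eInv gup : (Fin n → ℝ) → Fin n → Fin n → ℝ}
variable {z : Fin n → ℝ}
variable {C : Type*} [Ring C] [Algebra ℝ C] {lam : ℝ} {γ : Fin n → C}

/-- The spin connection term `Ω_A = -(1/4λ) Σ ω^b{}_{Ac} γ_b γ_c`. -/
noncomputable def spinOmega (lam : ℝ) (γ : Fin n → C)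
    (e eInv gup : (Fin n → ℝ) → Fin n → Fin n → ℝ) (A : Fin n) (w : Fin n → ℝ) : C :=
  (-(1 / (4 * lam))) • quad γ (spM e eInv gup A w)

/-- The curved gamma matrices `γ^A`. -/
def curvedGamma (γ : Fin n → C) (eInv : (Fin n → ℝ) → Fin n → Fin n → ℝ) (A : Fin n)
    (w : Fin n → ℝ) : C :=
  ∑ a, eInv w A a • γ a

theorem sum_antisymm_commutator {M : Matrix (Fin n) (Fin n) ℝ} (hM : ∀ b c, M c b = -M b c) :
    (1 / (8 * lam)) • ∑ b, ∑ c, M b c • (γ c * γ b - γ b * γ c)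
      = (-(1 / (4 * lam))) • quad γ M := by
  have h1 : ∑ b, ∑ c, M b c • (γ c * γ b) = -quad γ M := by
    rw [Finset.sum_comm, quad, ← Finset.sum_neg_distrib]
    refine Finset.sum_congr rfl fun b _ => ?_
    rw [← Finset.sum_neg_distrib]
    exact Finset.sum_congr rfl fun c _ => by rw [hM b c, neg_smul]
  simp only [smul_sub, Finset.sum_sub_distrib]
  rw [h1, ← quad.eq_def, smul_neg, ← neg_smul, ← sub_smul]
  congr 1
  ring

theorem IsVielbein.spinOmega_commutator (h : IsVielbein U e eInv gup) (hγ : IsClifford lam γ)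
    (hlam : lam ≠ 0) (A B : Fin n) (hz : z ∈ U) :
    spinOmega lam γ e eInv gup A z * curvedGamma γ eInv B z
        - curvedGamma γ eInv B z * spinOmega lam γ e eInv gup A z
      = ∑ b, (of (eInv z) * spM e eInv gup A z) B b • γ b := by
  have h1 : ∀ a, spinOmega lam γ e eInv gup A z * γ a - γ a * spinOmega lam γ e eInv gup A z
      = ∑ b, spM e eInv gup A z a b • γ b := by
    intro a
    rw [spinOmega, smul_mul_assoc, mul_smul_comm, ← smul_sub,
      hγ.quad_commutator (h.spM_antisymm A hz), smul_smul]
    have : -(1 / (4 * lam)) * (4 * lam) = -1 := by field_simp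
    rw [this, neg_one_smul, ← Finset.sum_neg_distrib]
    refine Finset.sum_congr rfl fun b _ => ?_
    rw [h.spM_antisymm A hz b a, neg_smul]
  simp only [curvedGamma, Finset.mul_sum, Finset.sum_mul, smul_mul_assoc, mul_smul_comm,
    ← Finset.sum_sub_distrib, ← smul_sub, h1, mul_apply, Finset.sum_smul, Finset.smul_sum,
    smul_smul, of_apply]
  exact Finset.sum_comm

theorem IsVielbein.curvedGamma_mul_add (h : IsVielbein U e eInv gup) (hγ : IsClifford lam γ)
    (A B : Fin n) (hz : z ∈ U) :
    curvedGamma γ eInv A z * curvedGamma γ eInv B z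
        + curvedGamma γ eInv B z * curvedGamma γ eInv A z
      = (2 * lam * gup z A B) • (1 : C) := by
  have h1 : curvedGamma γ eInv B z * curvedGamma γ eInv A z
      = ∑ a, ∑ b, (eInv z A a * eInv z B b) • (γ b * γ a) := by
    simp only [curvedGamma, Finset.mul_sum, Finset.sum_mul, smul_mul_assoc, mul_smul_comm,
      Finset.smul_sum, smul_smul]
  have h2 : curvedGamma γ eInv A z * curvedGamma γ eInv B z
      = ∑ a, ∑ b, (eInv z A a * eInv z B b) • (γ a * γ b) := by
    simp only [curvedGamma, Finset.mul_sum, Finset.sum_mul, smul_mul_assoc, mul_smul_comm,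
      Finset.smul_sum, smul_smul]
    rw [Finset.sum_comm]
    simp only [mul_comm]
  have h3 : gup z A B = ∑ a, eInv z A a * eInv z B a := by
    have := congrFun (congrFun (h.gup_eq hz) A) B
    simpa [mul_apply] using this
  rw [h1, h2, h3]
  simp only [← Finset.sum_add_distrib, ← smul_add, hγ _ _, ite_smul, zero_smul, smul_ite,
    smul_zero, Finset.sum_ite_eq, Finset.mem_univ, if_true, smul_smul, ← Finset.sum_smul,
    Finset.mul_sum]
  congr 1
  exact Finset.sum_congr rfl fun a _ => by ring

/-- The curvature of the spin connection with its form indices in the orthonormal frame. -/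
noncomputable def frameCurv (e eInv gup : (Fin n → ℝ) → Fin n → Fin n → ℝ) (z : Fin n → ℝ)
    (d a b c : Fin n) : ℝ :=
  ∑ A, ∑ B, eInv z A a * eInv z B b * spinCurv e eInv gup A B z d c

theorem IsVielbein.frameCurv_cyclic (h : IsVielbein U e eInv gup) (hz : z ∈ U)
    (d a b c : Fin n) :
    frameCurv e eInv gup z d a b c + frameCurv e eInv gup z d b c a
      + frameCurv e eInv gup z d c a b = 0 := by
  have hT : ∀ a b c, frameCurv e eInv gup z d a b c
      = ∑ A, ∑ B, ∑ K, eInv z A a * eInv z B b * eInv z K c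
        * ∑ D, e z d D * riemM e gup A B z D K := by
    intro a b c
    refine Finset.sum_congr rfl fun A _ => Finset.sum_congr rfl fun B _ => ?_
    rw [h.spinCurv_eq A B hz, mul_apply, Finset.mul_sum]
    refine Finset.sum_congr rfl fun K _ => ?_
    simp only [mul_apply, of_apply]
    ring
  rw [hT, hT b, hT c,
    ← sum_cycle fun A B K => eInv z A b * eInv z B c * eInv z K a
        * ∑ D, e z d D * riemM e gup A B z D K,
    ← sum_cycle fun A B K => eInv z A c * eInv z B a * eInv z K b
        * ∑ D, e z d D * riemM e gup A B z D K,
    ← sum_cycle fun A B K => eInv z B c * eInv z K a * eInv z A b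
        * ∑ D, e z d D * riemM e gup B K z D A]
  simp only [← Finset.sum_add_distrib]
  refine Finset.sum_eq_zero fun A _ => Finset.sum_eq_zero fun B _ => Finset.sum_eq_zero fun K _ => ?_
  have h0 : ∑ D, e z d D * riemM e gup A B z D K + ∑ D, e z d D * riemM e gup B K z D A
      + ∑ D, e z d D * riemM e gup K A z D B = 0 := by
    simp only [← Finset.sum_add_distrib, ← mul_add, riemM_cyclic, mul_zero, Finset.sum_const_zero]
  linear_combination (eInv z A a * eInv z B b * eInv z K c) * h0

theorem IsVielbein.sum_frameCurv (h : IsVielbein U e eInv gup) (hz : z ∈ U) :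
    ∑ d, ∑ a, frameCurv e eInv gup z d d a a = scal gup (glowE e) z := by
  have h1 : ∑ d, ∑ a, frameCurv e eInv gup z d d a a
      = ∑ A, ∑ B, (of (eInv z) * spinCurv e eInv gup A B z * (of (eInv z))ᵀ) A B := by
    simp only [frameCurv, mul_apply, transpose_apply, of_apply, Finset.sum_mul]
    rw [sum_comm_pair]
    refine Finset.sum_congr rfl fun A _ => Finset.sum_congr rfl fun B _ => ?_
    rw [Finset.sum_comm]
    exact Finset.sum_congr rfl fun a _ => Finset.sum_congr rfl fun d _ => by ring
  have h2 : ∀ A B, of (eInv z) * spinCurv e eInv gup A B z * (of (eInv z))ᵀ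
      = riemM e gup A B z * of (gup z) := by
    intro A B
    rw [h.spinCurv_eq A B hz, h.gup_eq hz, Matrix.mul_assoc (of (e z)), ← Matrix.mul_assoc,
      h.inv_mul z hz, Matrix.one_mul, Matrix.mul_assoc]
  simp only [h1, h2]
  simp only [scal, ricci, mul_apply, riemM, of_apply, Finset.mul_sum]
  rw [Finset.sum_comm]
  refine Finset.sum_congr rfl fun B _ => ?_
  rw [Finset.sum_comm]
  exact Finset.sum_congr rfl fun K _ => Finset.sum_congr rfl fun A _ => mul_comm _ _

/-- The Clifford contraction of the spin curvature is the scalar curvature. -/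
theorem IsVielbein.sum_gamma_spinCurv (h : IsVielbein U e eInv gup) (hγ : IsClifford lam γ)
    (hz : z ∈ U) :
    ∑ A, ∑ B, curvedGamma γ eInv A z * curvedGamma γ eInv B z
        * quad γ (spinCurv e eInv gup A B z)
      = (-2 * lam ^ 2 * scal gup (glowE e) z) • (1 : C) := by
  rw [← h.sum_frameCurv hz, ← hγ.sum_four (T := frameCurv e eInv gup z)]
  · have h1 : ∀ A B, curvedGamma γ eInv A z * curvedGamma γ eInv B z
          * quad γ (spinCurv e eInv gup A B z)
        = ∑ a, ∑ b, ∑ d, ∑ c, (eInv z A a * eInv z B b * spinCurv e eInv gup A B z d c)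
            • (γ a * γ b * (γ d * γ c)) := by
      intro A B
      simp only [curvedGamma, quad, Finset.mul_sum, Finset.sum_mul, smul_mul_assoc,
        mul_smul_comm, Finset.smul_sum, smul_smul]
      rw [sum_comm_pair, Finset.sum_comm]
      refine Finset.sum_congr rfl fun a _ => Finset.sum_congr rfl fun b _ =>
        Finset.sum_congr rfl fun d _ => Finset.sum_congr rfl fun c _ => ?_
      congr 1
      ring
    simp only [h1, frameCurv, Finset.sum_smul]
    rw [sum_comm_pair, Finset.sum_comm (γ := Fin n)
      (f := fun d a => ∑ b, ∑ c, ∑ A, ∑ B, _ • (γ a * γ b * (γ d * γ c)))]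
    refine Finset.sum_congr rfl fun a _ => ?_
    rw [Finset.sum_comm (f := fun d b => ∑ c, ∑ A, ∑ B, _ • (γ a * γ b * (γ d * γ c)))]
    exact Finset.sum_congr rfl fun b _ => sum_comm_pair _
  · intro d a b c
    rw [frameCurv, Finset.sum_comm, frameCurv, ← Finset.sum_neg_distrib]
    refine Finset.sum_congr rfl fun A _ => ?_
    rw [← Finset.sum_neg_distrib]
    refine Finset.sum_congr rfl fun B _ => ?_
    rw [spinCurv_swap A B, Matrix.neg_apply]
    ring
  · intro d a b c
    simp only [frameCurv, ← Finset.sum_neg_distrib]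
    refine Finset.sum_congr rfl fun A _ => Finset.sum_congr rfl fun B _ => ?_
    rw [h.spinCurv_antisymm A B hz d c]
    ring
  · exact h.frameCurv_cyclic hz

end SpinorConnection

section SpinorCalculus

open Matrix

variable {n : ℕ} {U : Set (Fin n → ℝ)} {e eInv gup : (Fin n → ℝ) → Fin n → Fin n → ℝ}
variable {z : Fin n → ℝ}
variable {C : Type*} [Ring C] [Algebra ℝ C] {lam : ℝ} {γ : Fin n → C}

theorem IsVielbein.smooth_spinOmega (h : IsVielbein U e eInv gup) (A : Fin n) :
    VSmooth U (spinOmega lam γ e eInv gup A) :=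
  VSmooth.smul contDiffOn_const <| VSmooth.sum fun b _ => VSmooth.sum fun c _ =>
    VSmooth.smul (h.smooth_spM A b c) (VSmooth.const _)

theorem IsVielbein.smooth_curvedGamma (h : IsVielbein U e eInv gup) (A : Fin n) :
    VSmooth U (curvedGamma γ eInv A) :=
  VSmooth.sum fun a _ => VSmooth.smul (h.smooth_inv A a) (VSmooth.const _)

variable [Module.Finite ℝ C]

theorem IsVielbein.vpd_spinOmega (h : IsVielbein U e eInv gup) (A B : Fin n) (hz : z ∈ U) :
    vpd A (spinOmega lam γ e eInv gup B) z
      = (-(1 / (4 * lam))) • quad γ (mpd A (spM e eInv gup B) z) := by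
  have hs : ∀ b c, VSmooth U fun w => spM e eInv gup B w b c • (γ b * γ c) := fun b c =>
    VSmooth.smul (h.smooth_spM B b c) (VSmooth.const _)
  have hq : VSmooth U fun w => quad γ (spM e eInv gup B w) :=
    VSmooth.sum fun b _ => VSmooth.sum fun c _ => hs b c
  have h1 : vpd A (fun w => quad γ (spM e eInv gup B w)) z
      = quad γ (mpd A (spM e eInv gup B) z) := by
    simp only [quad]
    rw [vpd_sum h.isOpen (fun b _ => VSmooth.sum fun c _ => hs b c) hz]
    refine Finset.sum_congr rfl fun b _ => ?_
    rw [vpd_sum h.isOpen (fun c _ => hs b c) hz]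
    exact Finset.sum_congr rfl fun c _ => vpd_smul_const h.isOpen (h.smooth_spM B b c) _ hz
  have h2 := vpd_smul (A := A) (f := fun _ => -(1 / (4 * lam))) h.isOpen contDiffOn_const hq hz
  rw [pd_const, zero_smul, zero_add, h1] at h2
  exact h2

/-- Covariant constancy of the gamma matrices. -/
theorem IsVielbein.vpd_curvedGamma (h : IsVielbein U e eInv gup) (hγ : IsClifford lam γ)
    (hlam : lam ≠ 0) (A B : Fin n) (hz : z ∈ U) :
    vpd A (curvedGamma γ eInv B) z
        = spinOmega lam γ e eInv gup A z * curvedGamma γ eInv B z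
          - curvedGamma γ eInv B z * spinOmega lam γ e eInv gup A z
          - ∑ K, chM e gup A z B K • curvedGamma γ eInv K z := by
  have h1 : vpd A (curvedGamma γ eInv B) z
      = ∑ a, mpd A (fun w => of (eInv w)) z B a • γ a := by
    have := vpd_sum (A := A) (s := Finset.univ) (F := fun a w => eInv w B a • γ a) h.isOpen
      (fun a _ => VSmooth.smul (h.smooth_inv B a) (VSmooth.const _)) hz
    refine this.trans (Finset.sum_congr rfl fun a _ => ?_)
    exact vpd_smul_const h.isOpen (h.smooth_inv B a) _ hz
  rw [h.spinOmega_commutator hγ hlam A B hz, h1, h.mpd_inv A hz]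
  simp only [Matrix.sub_apply, sub_smul, Finset.sum_sub_distrib]
  congr 1
  simp only [curvedGamma, Finset.smul_sum, mul_apply, Finset.sum_smul, smul_smul, of_apply]
  exact Finset.sum_comm

/-- The covariant derivative `∂_A F - Ω_A F` of a spinor field. -/
noncomputable def covD (lam : ℝ) (γ : Fin n → C) (e eInv gup : (Fin n → ℝ) → Fin n → Fin n → ℝ)
    (A : Fin n) (F : (Fin n → ℝ) → C) (w : Fin n → ℝ) : C :=
  vpd A F w - spinOmega lam γ e eInv gup A w * F w

theorem IsVielbein.smooth_covD (h : IsVielbein U e eInv gup) (A : Fin n)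
    {F : (Fin n → ℝ) → C} (hF : VSmooth U F) : VSmooth U (covD lam γ e eInv gup A F) :=
  (hF.partialDeriv h.isOpen).sub ((h.smooth_spinOmega A).mul hF)

/-- The Ricci identity for spinor fields. -/
theorem IsVielbein.covD_comm (h : IsVielbein U e eInv gup) (hγ : IsClifford lam γ)
    (hlam : lam ≠ 0) (A B : Fin n) {F : (Fin n → ℝ) → C} (hF : VSmooth U F) (hz : z ∈ U) :
    covD lam γ e eInv gup A (covD lam γ e eInv gup B F) z
        - covD lam γ e eInv gup B (covD lam γ e eInv gup A F) z
      = (1 / (4 * lam)) • (quad γ (spinCurv e eInv gup A B z) * F z) := by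
  have h1 : ∀ A B, covD lam γ e eInv gup A (covD lam γ e eInv gup B F) z
      = vpd A (vpd B F) z - (vpd A (spinOmega lam γ e eInv gup B) z * F z
          + spinOmega lam γ e eInv gup B z * vpd A F z)
        - spinOmega lam γ e eInv gup A z
          * (vpd B F z - spinOmega lam γ e eInv gup B z * F z) := by
    intro A B
    have h2 : vpd A (covD lam γ e eInv gup B F) z = _ :=
      vpd_sub h.isOpen (hF.partialDeriv h.isOpen) ((h.smooth_spinOmega B).mul hF) hz
    rw [covD, h2, vpd_mul h.isOpen (h.smooth_spinOmega B) hF hz, covD]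
  have h3 : spinOmega lam γ e eInv gup A z * spinOmega lam γ e eInv gup B z
        - spinOmega lam γ e eInv gup B z * spinOmega lam γ e eInv gup A z
      = (1 / (4 * lam)) • quad γ (spM e eInv gup A z * spM e eInv gup B z
          - spM e eInv gup B z * spM e eInv gup A z) := by
    simp only [spinOmega, smul_mul_assoc, mul_smul_comm, smul_smul, ← smul_sub]
    rw [hγ.quad_mul_quad_sub (h.spM_antisymm A hz), smul_smul]
    congr 1
    field_simp
  have h4 : (1 / (4 * lam)) • quad γ (spinCurv e eInv gup A B z)
      = vpd B (spinOmega lam γ e eInv gup A) z - vpd A (spinOmega lam γ e eInv gup B) z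
        + (spinOmega lam γ e eInv gup A z * spinOmega lam γ e eInv gup B z
          - spinOmega lam γ e eInv gup B z * spinOmega lam γ e eInv gup A z) := by
    rw [h3, h.vpd_spinOmega B A hz, h.vpd_spinOmega A B hz, spinCurv, quad_add, quad_sub]
    module
  rw [h1, h1, vpd_comm (A := B) (B := A) h.isOpen hF hz, ← smul_mul_assoc, h4]
  noncomm_ring

/-- The Schrödinger–Lichnerowicz formula for a Clifford family `γ` acting on a
finite-dimensional algebra. -/
theorem IsVielbein.dirac_sq (h : IsVielbein U e eInv gup) (hγ : IsClifford lam γ)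
    (hlam : lam ≠ 0) (hρ : rhoE e z ≠ 0) {F : (Fin n → ℝ) → C} (hF : VSmooth U F) (hz : z ∈ U) :
    ∑ A, curvedGamma γ eInv A z * covD lam γ e eInv gup A
        (fun w => ∑ B, curvedGamma γ eInv B w * covD lam γ e eInv gup B F w) z
      = lam • ((rhoE e z)⁻¹ • ∑ A, ∑ B, covD lam γ e eInv gup A
          (fun w => (rhoE e w * gup w A B) • covD lam γ e eInv gup B F w) z)
        - (lam / 4 * scal gup (glowE e) z) • F z := by
  let X : Fin n → (Fin n → ℝ) → C := fun B => covD lam γ e eInv gup B F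
  have hXs : ∀ B, VSmooth U (X B) := fun B => h.smooth_covD B hF
  let Y : Fin n → Fin n → C := fun A B => covD lam γ e eInv gup A (X B) z
  let G : Fin n → C := fun A => curvedGamma γ eInv A z
  have hL : ∀ A, covD lam γ e eInv gup A (fun w => ∑ B, curvedGamma γ eInv B w * X B w) z
      = ∑ B, G B * Y A B - ∑ B, ∑ K, chM e gup A z B K • (G K * X B z) := by
    intro A
    rw [covD, vpd_sum h.isOpen (fun B _ => (h.smooth_curvedGamma B).mul (hXs B)) hz,
      Finset.mul_sum, ← Finset.sum_sub_distrib, ← Finset.sum_sub_distrib]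
    refine Finset.sum_congr rfl fun B _ => ?_
    rw [vpd_mul h.isOpen (h.smooth_curvedGamma B) (hXs B) hz, h.vpd_curvedGamma hγ hlam A B hz]
    simp only [← smul_mul_assoc, ← Finset.sum_mul]
    simp only [Y, G, covD]
    noncomm_ring
  have hR : ∀ A B, covD lam γ e eInv gup A (fun w => (rhoE e w * gup w A B) • X B w) z
      = pd A (fun w => rhoE e w * gup w A B) z • X B z + (rhoE e z * gup z A B) • Y A B := by
    intro A B
    have hs : Smooth U fun w => rhoE e w * gup w A B :=
      ContDiffOn.mul h.smooth_rhoE (h.smooth_gup A B)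
    rw [covD, vpd_smul h.isOpen hs (hXs B) hz, mul_smul_comm, add_sub_assoc, ← smul_sub]
    rfl
  have hGG : ∀ A B, G A * G B + G B * G A = (2 * lam * gup z A B) • (1 : C) := fun A B =>
    h.curvedGamma_mul_add hγ A B hz
  have half : ∀ {x y : C}, (2 : ℝ) • x = (2 : ℝ) • y → x = y := fun hxy =>
    smul_right_injective C (two_ne_zero (α := ℝ)) hxy
  have hfirst : ∑ A, ∑ B, ∑ K, chM e gup A z B K • (G A * G K * X B z)
      = lam • ∑ B, (∑ A, ∑ K, gup z A K * chM e gup A z B K) • X B z := by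
    refine half ?_
    have hsw : ∑ A, ∑ B, ∑ K, chM e gup A z B K • (G A * G K * X B z)
        = ∑ A, ∑ B, ∑ K, chM e gup A z B K • (G K * G A * X B z) := by
      rw [Finset.sum_comm, Finset.sum_comm (γ := Fin n)
        (f := fun A B => ∑ K, chM e gup A z B K • (G K * G A * X B z))]
      refine Finset.sum_congr rfl fun B _ => ?_
      rw [Finset.sum_comm]
      exact Finset.sum_congr rfl fun A _ => Finset.sum_congr rfl fun K _ => by rw [chM_symm]
    rw [two_smul]
    nth_rewrite 2 [hsw]
    simp only [← Finset.sum_add_distrib, ← smul_add, ← add_mul, hGG, smul_mul_assoc, one_mul]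
    rw [Finset.sum_comm]
    simp only [Finset.smul_sum, Finset.sum_smul, smul_smul]
    refine Finset.sum_congr rfl fun B _ => Finset.sum_congr rfl fun A _ =>
      Finset.sum_congr rfl fun K _ => ?_
    congr 1
    ring
  have hsecond : ∑ A, ∑ B, G A * G B * Y A B
      = lam • ∑ A, ∑ B, gup z A B • Y A B - (lam / 4 * scal gup (glowE e) z) • F z := by
    refine half ?_
    have hcomm : ∑ A, ∑ B, G A * G B * (Y A B - Y B A)
        = (-(lam / 2) * scal gup (glowE e) z) • F z := by
      have hYY : ∀ A B, Y A B - Y B A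
          = (1 / (4 * lam)) • (quad γ (spinCurv e eInv gup A B z) * F z) := fun A B =>
        h.covD_comm hγ hlam A B hF hz
      simp only [hYY, mul_smul_comm, ← mul_assoc, ← Finset.smul_sum, ← Finset.sum_mul]
      rw [h.sum_gamma_spinCurv hγ hz, smul_mul_assoc, one_mul, smul_smul]
      congr 1
      field_simp
      ring
    have hsymm : ∑ A, ∑ B, G A * G B * Y B A
        = (2 * lam) • ∑ A, ∑ B, gup z A B • Y A B - ∑ A, ∑ B, G A * G B * Y A B := by
      rw [Finset.sum_comm, eq_sub_iff_add_eq]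
      simp only [← Finset.sum_add_distrib, ← add_mul, Finset.smul_sum, smul_smul]
      refine Finset.sum_congr rfl fun A _ => Finset.sum_congr rfl fun B _ => ?_
      rw [add_comm (G B * G A), hGG, smul_mul_assoc, one_mul]
    simp only [mul_sub, Finset.sum_sub_distrib] at hcomm
    rw [hsymm, sub_eq_iff_eq_add] at hcomm
    rw [two_smul, ← add_sub_cancel_right (∑ A, ∑ B, G A * G B * Y A B) 0]
    nth_rewrite 1 [hcomm]
    module
  have hlhs : ∑ A, G A * (∑ B, G B * Y A B - ∑ B, ∑ K, chM e gup A z B K • (G K * X B z))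
      = ∑ A, ∑ B, G A * G B * Y A B - ∑ A, ∑ B, ∑ K, chM e gup A z B K • (G A * G K * X B z) := by
    simp only [mul_sub, Finset.mul_sum, Finset.sum_sub_distrib, mul_smul_comm, mul_assoc]
  have hdiv : ∑ A, ∑ B, pd A (fun w => rhoE e w * gup w A B) z • X B z
      = -(rhoE e z • ∑ B, (∑ A, ∑ K, gup z A K * chM e gup A z B K) • X B z) := by
    rw [Finset.sum_comm, Finset.smul_sum, ← Finset.sum_neg_distrib]
    refine Finset.sum_congr rfl fun B _ => ?_
    rw [← Finset.sum_smul, h.sum_pd_rhoE_mul_gup B hz, neg_smul, smul_smul]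
  have hlap : ∑ A, ∑ B, (rhoE e z * gup z A B) • Y A B
      = rhoE e z • ∑ A, ∑ B, gup z A B • Y A B := by
    simp only [Finset.smul_sum, smul_smul]
  change ∑ A, G A * covD lam γ e eInv gup A (fun w => ∑ B, curvedGamma γ eInv B w * X B w) z
      = lam • ((rhoE e z)⁻¹ • ∑ A, ∑ B, covD lam γ e eInv gup A
          (fun w => (rhoE e w * gup w A B) • X B w) z) - _
  simp only [hL, hR, Finset.sum_add_distrib]
  rw [hlhs, hfirst, hsecond, hdiv, hlap, smul_add, smul_neg, inv_smul_smul₀ hρ,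
    inv_smul_smul₀ hρ, smul_add, smul_neg]
  abel

end SpinorCalculus

section CliffordAlgebra

variable {n : ℕ} {Q : QuadraticForm ℝ (EuclideanSpace ℝ (Fin n))} {lam : ℝ}

theorem finite_cliffordAlgebra (Q : QuadraticForm ℝ (EuclideanSpace ℝ (Fin n))) :
    Module.Finite ℝ (CliffordAlgebra Q) :=
  letI : Invertible (2 : ℝ) := invertibleOfNonzero two_ne_zero
  have := Module.Finite.of_basis
    (EuclideanSpace.basisFun (Fin n) ℝ).toBasis.ExteriorAlgebra
  Module.Finite.equiv (CliffordAlgebra.equivExterior Q).symm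

theorem isClifford_gammaFlat (hQ : ∀ x, Q x = lam * ‖x‖ ^ 2) : IsClifford lam (gammaFlat Q) := by
  intro a b
  have hp : QuadraticMap.polar Q (EuclideanSpace.single a (1 : ℝ)) (EuclideanSpace.single b 1)
      = if a = b then 2 * lam else 0 := by
    simp only [QuadraticMap.polar, hQ, norm_add_sq_real, EuclideanSpace.inner_single_left,
      PiLp.single_apply, map_one, one_mul]
    split_ifs with hab
    · ring
    · ring
  rw [gammaFlat, gammaFlat, CliffordAlgebra.ι_mul_ι_add_swap, hp, Algebra.algebraMap_eq_smul_one]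

end CliffordAlgebra

end Lichnerowicz

open Lichnerowicz

/-- the Schrödinger–Lichnerowicz formula in local coordinates:
`D(Dψ) = λ·Δ^{(σ)}ψ − (λ/4)·R·ψ` pointwise on `U`, for every smooth spinor field `ψ` with
values in the Clifford algebra `Cl_λ(n)` of the form `x ↦ λ‖x‖²` on Euclidean `ℝⁿ`.
Here `Dψ := Σ_A γ^A·(∂_Aψ − Ω_A·ψ)`,
`Δ^{(σ)}ψ := (1/ρ_g)·Σ_{A,B} (∂_A − Ω_A·)(ρ_g·g^{AB}·(∂_Bψ − Ω_B·ψ))`, and `R` is the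
Levi–Civita scalar curvature of the metric induced by the vielbein `e`.  Partial derivatives
of Clifford-algebra-valued functions are encoded weakly, through linear functionals `φ`. -/
theorem stmt17 {n : ℕ} (U : Set (Fin n → ℝ)) (hU : IsOpen U)
    (lam : ℝ) (hlam : lam ≠ 0)
    (Q : QuadraticForm ℝ (EuclideanSpace ℝ (Fin n)))
    (hQ : ∀ x, Q x = lam * ‖x‖ ^ 2)
    -- the vielbein and its pointwise inverse
    (e eInv : (Fin n → ℝ) → Fin n → Fin n → ℝ)
    (he : ∀ a A, ContDiffOn ℝ (⊤ : ℕ∞) (fun z => e z a A) U)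
    (heInv : ∀ z ∈ U, ∀ a b, ∑ A, e z a A * eInv z A b = if a = b then 1 else 0)
    (heInv' : ∀ z ∈ U, ∀ A B, ∑ a, eInv z A a * e z a B = if A = B then 1 else 0)
    (hdet : ∀ z ∈ U, 0 < rhoE e z)
    -- the inverse `g^{AB}` of the induced metric `g_{AB} = Σ_a e^a{}_A e^a{}_B`
    (gup : (Fin n → ℝ) → Fin n → Fin n → ℝ)
    (hgup : ∀ z ∈ U, ∀ A C, ∑ B, glowE e z A B * gup z B C = if A = C then 1 else 0)
    -- the smooth spinor field `ψ`, with partial derivatives `dψ A = ∂_A ψ`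
    (ψ : (Fin n → ℝ) → CliffordAlgebra Q)
    (dψ : Fin n → (Fin n → ℝ) → CliffordAlgebra Q)
    (hψsmooth : ∀ φ : Module.Dual ℝ (CliffordAlgebra Q),
      ContDiffOn ℝ (⊤ : ℕ∞) (fun w => φ (ψ w)) U)
    (hdψ : ∀ (φ : Module.Dual ℝ (CliffordAlgebra Q)) (A : Fin n), ∀ z ∈ U,
      φ (dψ A z) = pd A (fun w => φ (ψ w)) z)
    -- `dDψ A = ∂_A (Dψ)`
    (dDψ : Fin n → (Fin n → ℝ) → CliffordAlgebra Q)
    (hdDψ : ∀ (φ : Module.Dual ℝ (CliffordAlgebra Q)) (A : Fin n), ∀ z ∈ U,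
      φ (dDψ A z) = pd A (fun w => φ (diracSpin Q lam e eInv gup ψ dψ w)) z)
    -- `dH A B = ∂_A (ρ_g·g^{AB}·(∂_Bψ − Ω_B·ψ))`
    (dH : Fin n → Fin n → (Fin n → ℝ) → CliffordAlgebra Q)
    (hdH : ∀ (φ : Module.Dual ℝ (CliffordAlgebra Q)) (A B : Fin n), ∀ z ∈ U,
      φ (dH A B z) = pd A (fun w => φ (innerSpinLap Q lam e eInv gup ψ dψ A B w)) z) :
    ∀ z ∈ U,
      ∑ A, gammaCurved Q eInv A z *
          (dDψ A z - OmegaSpin Q lam e eInv gup A z * diracSpin Q lam e eInv gup ψ dψ z)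
        = lam • ((rhoE e z)⁻¹ • ∑ A, ∑ B,
              (dH A B z - OmegaSpin Q lam e eInv gup A z * innerSpinLap Q lam e eInv gup ψ dψ A B z))
          - (lam / 4 * scal gup (glowE e) z) • ψ z := by
  have h : IsVielbein U e eInv gup :=
    { isOpen := hU
      smooth := he
      mul_inv := fun w hw => by
        ext a b
        simp [Matrix.mul_apply, Matrix.one_apply, heInv w hw]
      inv_mul := fun w hw => by
        ext a b
        simp [Matrix.mul_apply, Matrix.one_apply, heInv' w hw]
      metric := fun w hw => by
        ext a b
        simp [Matrix.mul_apply, Matrix.one_apply, hgup w hw] }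
  have := finite_cliffordAlgebra Q
  have hγ := isClifford_gammaFlat hQ
  have hΩ : ∀ A, ∀ w ∈ U, OmegaSpin Q lam e eInv gup A w
      = spinOmega lam (gammaFlat Q) e eInv gup A w := fun A w hw =>
    sum_antisymm_commutator (h.spM_antisymm A hw)
  have hψ : VSmooth U ψ := hψsmooth
  have hX : ∀ B, ∀ w ∈ U, dψ B w - OmegaSpin Q lam e eInv gup B w * ψ w
      = covD lam (gammaFlat Q) e eInv gup B ψ w := fun B w hw => by
    rw [hΩ B w hw, eq_vpd hU hψ hw fun φ => hdψ φ B w hw, covD]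
  have hD : ∀ w ∈ U, diracSpin Q lam e eInv gup ψ dψ w
      = ∑ B, curvedGamma (gammaFlat Q) eInv B w * covD lam (gammaFlat Q) e eInv gup B ψ w :=
    fun w hw => Finset.sum_congr rfl fun B _ => by rw [hX B w hw]; rfl
  have hI : ∀ A B, ∀ w ∈ U, innerSpinLap Q lam e eInv gup ψ dψ A B w
      = (rhoE e w * gup w A B) • covD lam (gammaFlat Q) e eInv gup B ψ w :=
    fun A B w hw => by rw [innerSpinLap, hX B w hw]
  have hXs : ∀ B, VSmooth U (covD lam (gammaFlat Q) e eInv gup B ψ) := fun B => h.smooth_covD B hψ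
  have hDs : VSmooth U (diracSpin Q lam e eInv gup ψ dψ) :=
    (VSmooth.sum fun B _ => (h.smooth_curvedGamma B).mul (hXs B)).congr hD
  have hIs : ∀ A B, VSmooth U (innerSpinLap Q lam e eInv gup ψ dψ A B) := fun A B =>
    (VSmooth.smul (ContDiffOn.mul h.smooth_rhoE (h.smooth_gup A B)) (hXs B)).congr (hI A B)
  intro z hz
  have hdD : ∀ A, dDψ A z = vpd A (fun w => ∑ B, curvedGamma (gammaFlat Q) eInv B w
      * covD lam (gammaFlat Q) e eInv gup B ψ w) z := fun A => by
    rw [eq_vpd hU hDs hz fun φ => hdDψ φ A z hz, vpd_congr hU hz hD]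
  have hdI : ∀ A B, dH A B z = vpd A (fun w => (rhoE e w * gup w A B)
      • covD lam (gammaFlat Q) e eInv gup B ψ w) z := fun A B => by
    rw [eq_vpd hU (hIs A B) hz fun φ => hdH φ A B z hz, vpd_congr hU hz (hI A B)]
  simp only [hdD, hdI, hΩ _ z hz, hD z hz, hI _ _ z hz]
  exact h.dirac_sq hγ hlam (hdet z hz).ne' hψ hz
end

section
/- The square of the bispinor Dirac operator projected onto the singlet is the Laplace–Beltrami operator: for every λ ∈ ℝ with λ ≠ 0 and every smooth f : U → ℝ, D(D(f·1)) = λ·(Δ_{ρ_g} f)·1 in Cl_λ(n) pointwise on U, where the bispinor covariant derivative is ∇_A F := ∂_A F − (Ω_A·F − F·Ω_A) for smooth F : U → Cl_λ(n), D F := Σ_A γ^A·(∇_A F), Δ_{ρ_g} f := (1/ρ_g)·Σ_{A,B} ∂_A(ρ_g·g^{AB}·∂_B f) is the Laplace–Beltrami operator, and 1 is the identity of Cl_λ(n). -/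
/-- The bispinor Dirac operator applied to the scalar singlet `f·1`:
`D(f·1) := Σ_A γ^A·(∂_A(f·1) − (Ω_A·(f·1) − (f·1)·Ω_A))`. -/
noncomputable def diracBispinorScalar {n : ℕ} (Q : QuadraticForm ℝ (EuclideanSpace ℝ (Fin n)))
    (lam : ℝ) (e eInv gup : (Fin n → ℝ) → Fin n → Fin n → ℝ)
    (f : (Fin n → ℝ) → ℝ) (w : Fin n → ℝ) : CliffordAlgebra Q :=
  ∑ A, gammaCurved Q eInv A w *
    (pd A f w • (1 : CliffordAlgebra Q)
      - (OmegaSpin Q lam e eInv gup A w * (f w • (1 : CliffordAlgebra Q))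
         - (f w • (1 : CliffordAlgebra Q)) * OmegaSpin Q lam e eInv gup A w))

section MatrixIdentities

open Matrix

variable {n : ℕ}

/-- The derivatives `∂_A g = (∂_A M)ᵀ M + Mᵀ ∂_A M` of the metric `g = Mᵀ M`. -/
def metricDeriv (M : Matrix (Fin n) (Fin n) ℝ) (dM : Fin n → Matrix (Fin n) (Fin n) ℝ)
    (A : Fin n) : Matrix (Fin n) (Fin n) ℝ :=
  (dM A)ᵀ * M + Mᵀ * dM A

/-- The matrix `(Γ_{DAC})_{D,C}` of lowered Christoffel symbols, in terms of the derivatives `dg`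
of the metric. -/
noncomputable def christMatrix (dg : Fin n → Matrix (Fin n) (Fin n) ℝ) (A : Fin n) :
    Matrix (Fin n) (Fin n) ℝ :=
  of fun D C => (dg A D C + dg C D A - dg D A C) / 2

/-- The matrix `(ω^b{}_{Ac})_{b,c}` of the spin connection, where `N = M⁻¹` and `N Nᵀ` is the
inverse metric. -/
noncomputable def spinMatrix (M N : Matrix (Fin n) (Fin n) ℝ)
    (dM : Fin n → Matrix (Fin n) (Fin n) ℝ) (A : Fin n) : Matrix (Fin n) (Fin n) ℝ :=
  M * (N * Nᵀ * christMatrix (metricDeriv M dM) A) * N - dM A * N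

variable {M N : Matrix (Fin n) (Fin n) ℝ} (dM : Fin n → Matrix (Fin n) (Fin n) ℝ)

lemma metricDeriv_symm (A D C : Fin n) : metricDeriv M dM A D C = metricDeriv M dM A C D := by
  have h : (metricDeriv M dM A)ᵀ = metricDeriv M dM A := by
    simp [metricDeriv, add_comm]
  exact congrFun (congrFun h C) D

lemma christMatrix_add_transpose (A : Fin n) :
    christMatrix (metricDeriv M dM) A + (christMatrix (metricDeriv M dM) A)ᵀ
      = metricDeriv M dM A := by
  ext D C
  simp only [christMatrix, Matrix.add_apply, transpose_apply, of_apply]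
  rw [metricDeriv_symm dM A C D, metricDeriv_symm dM C A D, metricDeriv_symm dM D A C]
  ring

lemma spinMatrix_eq (hMN : M * N = 1) (A : Fin n) :
    spinMatrix M N dM A = Nᵀ * christMatrix (metricDeriv M dM) A * N - dM A * N := by
  simp only [spinMatrix, ← Matrix.mul_assoc, hMN, Matrix.one_mul]

/-- The spin connection is metric. -/
lemma spinMatrix_transpose (hMN : M * N = 1) (A : Fin n) :
    (spinMatrix M N dM A)ᵀ = -spinMatrix M N dM A := by
  have hMN' : Nᵀ * Mᵀ = 1 := by rw [← transpose_mul, hMN, transpose_one]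
  rw [eq_neg_iff_add_eq_zero, spinMatrix_eq dM hMN]
  have h1 : Nᵀ * metricDeriv M dM A * N = Nᵀ * (dM A)ᵀ + dM A * N := by
    rw [metricDeriv, Matrix.mul_add, Matrix.add_mul, ← Matrix.mul_assoc, ← Matrix.mul_assoc, hMN',
      Matrix.one_mul, Matrix.mul_assoc, hMN, Matrix.mul_one]
  rw [← christMatrix_add_transpose, Matrix.mul_add, Matrix.add_mul] at h1
  simp only [transpose_sub, transpose_mul, transpose_transpose]
  rw [← Matrix.mul_assoc]
  rw [← sub_eq_zero] at h1
  rw [← h1]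
  abel

/-- The contracted Christoffel symbols `Γ^A{}_{AC}` are the logarithmic derivatives of `det M`. -/
lemma sum_christ_contract (hMN : M * N = 1) (C : Fin n) :
    ∑ A, (N * Nᵀ * christMatrix (metricDeriv M dM) A) A C = (N * dM C).trace := by
  have hMN' : Nᵀ * Mᵀ = 1 := by rw [← transpose_mul, hMN, transpose_one]
  have hsymm : ∀ A D, (N * Nᵀ) A D = (N * Nᵀ) D A := fun A D => by
    have : (N * Nᵀ)ᵀ = N * Nᵀ := by simp
    exact congrFun (congrFun this D) A
  have hswap : ∑ A, ∑ D, (N * Nᵀ) A D * metricDeriv M dM A D C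
      = ∑ A, ∑ D, (N * Nᵀ) A D * metricDeriv M dM D A C := by
    rw [Finset.sum_comm]
    exact Finset.sum_congr rfl fun A _ => Finset.sum_congr rfl fun D _ => by rw [hsymm]
  have htr : ∑ A, ∑ D, (N * Nᵀ) A D * metricDeriv M dM C D A = 2 * (N * dM C).trace := by
    change (N * Nᵀ * metricDeriv M dM C).trace = _
    rw [metricDeriv, Matrix.mul_add, trace_add, Matrix.mul_assoc N, Matrix.mul_assoc N,
      ← Matrix.mul_assoc Nᵀ Mᵀ, hMN', Matrix.one_mul, trace_mul_comm N, Matrix.mul_assoc Nᵀ,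
      Matrix.mul_assoc (dM C)ᵀ, hMN, Matrix.mul_one, ← transpose_mul, trace_transpose,
      trace_mul_comm N]
    rw [trace_mul_comm (dM C)]
    ring
  have hexp : ∑ A, (N * Nᵀ * christMatrix (metricDeriv M dM) A) A C
      = (∑ A, ∑ D, (N * Nᵀ) A D * metricDeriv M dM A D C
        + ∑ A, ∑ D, (N * Nᵀ) A D * metricDeriv M dM C D A
        - ∑ A, ∑ D, (N * Nᵀ) A D * metricDeriv M dM D A C) / 2 := by
    simp only [← Finset.sum_add_distrib, ← Finset.sum_sub_distrib, Finset.sum_div]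
    refine Finset.sum_congr rfl fun A _ => ?_
    rw [Matrix.mul_apply]
    exact Finset.sum_congr rfl fun D _ => by simp only [christMatrix, of_apply]; ring
  rw [hexp, hswap, htr]
  ring

/-- The flat components `∂_A V_b + ω^b{}_{Aa} V_a` of the covariant derivative of `V = M W` are
obtained from the curved ones `∂_A W^B + Γ^B{}_{AC} W^C` by applying `M`. -/
lemma covDeriv_flat (hNM : N * M = 1) (W : Fin n → ℝ) (dW : Fin n → Fin n → ℝ)
    (A : Fin n) :
    dM A *ᵥ W + M *ᵥ dW A + spinMatrix M N dM A *ᵥ (M *ᵥ W)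
      = M *ᵥ (dW A + (N * Nᵀ * christMatrix (metricDeriv M dM) A) *ᵥ W) := by
  rw [spinMatrix, mulVec_mulVec, Matrix.sub_mul, Matrix.mul_assoc _ N M, Matrix.mul_assoc _ N M,
    hNM, Matrix.mul_one, Matrix.mul_one, sub_mulVec, mulVec_add, mulVec_mulVec]
  abel

/-- `∇_A (dF)_D` is symmetric as soon as the second derivatives of `F` are. -/
lemma covDeriv_lower_symm (hMN : M * N = 1) (W : Fin n → ℝ) (dW : Fin n → Fin n → ℝ)
    (hess : ∀ A D, (metricDeriv M dM A *ᵥ W + (Mᵀ * M) *ᵥ dW A) D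
      = (metricDeriv M dM D *ᵥ W + (Mᵀ * M) *ᵥ dW D) A) (A D : Fin n) :
    ((Mᵀ * M) *ᵥ (dW A + (N * Nᵀ * christMatrix (metricDeriv M dM) A) *ᵥ W)) D
      = ((Mᵀ * M) *ᵥ (dW D + (N * Nᵀ * christMatrix (metricDeriv M dM) D) *ᵥ W)) A := by
  have hg : Mᵀ * M * (N * Nᵀ) = 1 := by
    rw [Matrix.mul_assoc, ← Matrix.mul_assoc M, hMN, Matrix.one_mul, ← transpose_mul]
    have : N * M = 1 := mul_eq_one_comm.mp hMN
    rw [this, transpose_one]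
  have key : ∀ A D, (christMatrix (metricDeriv M dM) A *ᵥ W) D - (metricDeriv M dM A *ᵥ W) D
      = (christMatrix (metricDeriv M dM) D *ᵥ W) A - (metricDeriv M dM D *ᵥ W) A := fun A D => by
    simp only [mulVec, dotProduct, ← Finset.sum_sub_distrib]
    refine Finset.sum_congr rfl fun C _ => ?_
    simp only [christMatrix, of_apply]
    rw [metricDeriv_symm dM C D A]
    ring
  have h := hess A D
  have k := key A D
  simp only [mulVec_add, Pi.add_apply, mulVec_mulVec, ← Matrix.mul_assoc] at h ⊢
  rw [Matrix.mul_assoc _ N Nᵀ, hg]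
  simp only [Matrix.one_mul]
  linarith

end MatrixIdentities

section CliffordIdentities

variable {n : ℕ} {R : Type*} [Ring R] [Algebra ℝ R] {lam : ℝ} {γ : Fin n → R}

/-- `[γ_cγ_b - γ_bγ_c, γ_a] = 4λ(δ_{ab}γ_c - δ_{ac}γ_b)`. -/
lemma clifford_commutator
    (h : ∀ a b, γ a * γ b + γ b * γ a = (if a = b then 2 * lam else 0) • (1 : R))
    (a b c : Fin n) :
    (γ c * γ b - γ b * γ c) * γ a - γ a * (γ c * γ b - γ b * γ c)
      = (4 * lam) • ((if b = a then (1 : ℝ) else 0) • γ c - (if c = a then (1 : ℝ) else 0) • γ b) := by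
  have e1 : (γ c * γ b - γ b * γ c) * γ a - γ a * (γ c * γ b - γ b * γ c)
      = (γ c * (γ b * γ a + γ a * γ b) - (γ c * γ a + γ a * γ c) * γ b)
        - (γ b * (γ c * γ a + γ a * γ c) - (γ b * γ a + γ a * γ b) * γ c) := by noncomm_ring
  rw [e1, h, h]
  simp only [mul_smul_comm, smul_mul_assoc, mul_one, one_mul]
  split_ifs <;> module

/-- For antisymmetric `ω`, the commutator with `Ω = (8λ)⁻¹ ω^b{}_c [γ_c, γ_b]` acts on
vectors as `-ω`. -/
lemma spin_commutator (hlam : lam ≠ 0)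
    (h : ∀ a b, γ a * γ b + γ b * γ a = (if a = b then 2 * lam else 0) • (1 : R))
    (ω : Matrix (Fin n) (Fin n) ℝ) (hω : ω.transpose = -ω) (V : Fin n → ℝ) :
    ((1 / (8 * lam)) • ∑ b, ∑ c, ω b c • (γ c * γ b - γ b * γ c)) * (∑ a, V a • γ a)
      - (∑ a, V a • γ a) * ((1 / (8 * lam)) • ∑ b, ∑ c, ω b c • (γ c * γ b - γ b * γ c))
      = -∑ b, (ω.mulVec V) b • γ b := by
  have hω' : ∀ b c, ω b c = - ω c b := fun b c => congrFun (congrFun hω c) b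
  have h1 : ∀ a, ((1 / (8 * lam)) • ∑ b, ∑ c, ω b c • (γ c * γ b - γ b * γ c)) * γ a
      - γ a * ((1 / (8 * lam)) • ∑ b, ∑ c, ω b c • (γ c * γ b - γ b * γ c))
      = -∑ b, ω b a • γ b := fun a => by
    simp only [smul_mul_assoc, mul_smul_comm, Finset.sum_mul, Finset.mul_sum, ← smul_sub,
      ← Finset.sum_sub_distrib, clifford_commutator h]
    have h2 : ∀ b c, ω b c • (4 * lam) • ((if b = a then (1 : ℝ) else 0) • γ c
        - (if c = a then (1 : ℝ) else 0) • γ b)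
        = (4 * lam) • ((if b = a then ω b c • γ c else 0) - (if c = a then ω b c • γ b else 0)) := by
      intro b c
      split_ifs <;> module
    simp only [h2, ← Finset.smul_sum, Finset.sum_sub_distrib]
    have h3 : ∑ b, ∑ c, (if b = a then ω b c • γ c else 0) = -∑ c, ω c a • γ c := by
      rw [Finset.sum_comm, ← Finset.sum_neg_distrib]
      refine Finset.sum_congr rfl fun c _ => ?_
      rw [Finset.sum_ite_eq' Finset.univ a, if_pos (Finset.mem_univ a), hω' a c, neg_smul]
    have h4 : ∑ b, ∑ c, (if c = a then ω b c • γ b else 0) = ∑ c, ω c a • γ c := by simp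
    rw [h3, h4, smul_smul]
    have h5 : 1 / (8 * lam) * (4 * lam) = 1 / 2 := by field_simp; norm_num
    rw [h5]
    module
  rw [Finset.mul_sum, Finset.sum_mul, ← Finset.sum_sub_distrib]
  simp only [mul_smul_comm (V _), smul_mul_assoc (V _), ← smul_sub, h1]
  simp only [smul_neg, Finset.sum_neg_distrib, Finset.smul_sum, smul_smul]
  rw [Finset.sum_comm]
  congr 1
  refine Finset.sum_congr rfl fun b _ => ?_
  rw [← Finset.sum_smul]
  simp only [Matrix.mulVec, dotProduct, mul_comm]

/-- Contracting a symmetric matrix with `γ_a γ_b` yields `λ` times its trace. -/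
lemma sum_symm_smul_clifford
    (h : ∀ a b, γ a * γ b + γ b * γ a = (if a = b then 2 * lam else 0) • (1 : R))
    (Y : Matrix (Fin n) (Fin n) ℝ) (hY : Y.IsSymm) :
    ∑ a, ∑ b, Y a b • (γ a * γ b) = (lam * Y.trace) • (1 : R) := by
  have h1 : (2 : ℝ) • ∑ a, ∑ b, Y a b • (γ a * γ b) = (2 : ℝ) • (lam * Y.trace) • (1 : R) := by
    rw [two_smul]
    nth_rw 2 [Finset.sum_comm]
    simp only [← Finset.sum_add_distrib]
    have : ∀ a b, Y a b • (γ a * γ b) + Y b a • (γ b * γ a)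
        = (if a = b then Y a b * (2 * lam) else 0) • (1 : R) := fun a b => by
      rw [hY.apply a b, ← smul_add, h, smul_smul, mul_ite, mul_zero]
    simp only [this, ← Finset.sum_smul, Finset.sum_ite_eq, Finset.mem_univ, if_true,
      ← Finset.sum_mul, smul_smul]
    congr 1
    simp only [Matrix.trace, Matrix.diag]
    ring
  exact smul_right_injective R (two_ne_zero' ℝ) h1

end CliffordIdentities

section PartialDerivatives

variable {n : ℕ} {z : Fin n → ℝ}

lemma pd_congr (A : Fin n) {f g : (Fin n → ℝ) → ℝ} {U : Set (Fin n → ℝ)} (hU : IsOpen U)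
    (hz : z ∈ U) (h : ∀ w ∈ U, f w = g w) : pd A f z = pd A g z := by
  have : f =ᶠ[nhds z] g := Filter.eventually_of_mem (hU.mem_nhds hz) h
  rw [pd, pd, this.fderiv_eq]

lemma pd_mul (A : Fin n) {f g : (Fin n → ℝ) → ℝ} (hf : DifferentiableAt ℝ f z)
    (hg : DifferentiableAt ℝ g z) :
    pd A (fun w => f w * g w) z = pd A f z * g z + f z * pd A g z := by
  simp only [pd]
  rw [fderiv_fun_mul hf hg]
  simp only [add_apply, smul_apply, smul_eq_mul]
  ring

lemma pd_sum (A : Fin n) {ι : Type*} [Fintype ι] {F : ι → (Fin n → ℝ) → ℝ}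
    (hF : ∀ i, DifferentiableAt ℝ (F i) z) :
    pd A (fun w => ∑ i, F i w) z = ∑ i, pd A (F i) z := by
  simp only [pd]
  rw [fderiv_fun_sum fun i _ => hF i]
  simp only [sum_apply]

lemma pd_sum_mul (A : Fin n) {ι : Type*} [Fintype ι] {F G : ι → (Fin n → ℝ) → ℝ}
    (hF : ∀ i, DifferentiableAt ℝ (F i) z) (hG : ∀ i, DifferentiableAt ℝ (G i) z) :
    pd A (fun w => ∑ i, F i w * G i w) z = ∑ i, pd A (F i) z * G i z + ∑ i, F i z * pd A (G i) z := by
  rw [pd_sum A fun i => (hF i).fun_mul (hG i),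
    Finset.sum_congr rfl fun i _ => pd_mul A (hF i) (hG i), Finset.sum_add_distrib]

lemma contDiffOn_pd (A : Fin n) {f : (Fin n → ℝ) → ℝ} {U : Set (Fin n → ℝ)} (hU : IsOpen U)
    (hf : ContDiffOn ℝ (⊤ : ℕ∞) f U) : ContDiffOn ℝ (⊤ : ℕ∞) (pd A f) U :=
  (hf.fderiv_of_isOpen hU (by simp)).clm_apply contDiffOn_const

lemma pd_comm (A B : Fin n) {f : (Fin n → ℝ) → ℝ} (hf : ContDiffAt ℝ (⊤ : ℕ∞) f z) :
    pd A (pd B f) z = pd B (pd A f) z := by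
  have hf2 : ContDiffAt ℝ 2 f z := hf.of_le (WithTop.coe_le_coe.2 (le_top : (2 : ℕ∞) ≤ ⊤))
  have hd : DifferentiableAt ℝ (fderiv ℝ f) z :=
    (hf2.fderiv_right (m := 1) (by norm_num)).differentiableAt (by norm_num)
  have hs : IsSymmSndFDerivAt ℝ f z := hf2.isSymmSndFDerivAt (by simp)
  have h : ∀ A B : Fin n, pd A (pd B f) z
      = fderiv ℝ (fderiv ℝ f) z (Pi.single A 1) (Pi.single B 1) := fun A B => by
    change fderiv ℝ (fun w => fderiv ℝ f w (Pi.single B 1)) z (Pi.single A 1) = _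
    rw [fderiv_clm_apply hd (differentiableAt_const _)]
    simp
  rw [h, h, hs]

/-- Jacobi's formula for the logarithmic derivative of a determinant. -/
lemma pd_det (A : Fin n) {M : (Fin n → ℝ) → Matrix (Fin n) (Fin n) ℝ}
    (hM : ∀ a B, DifferentiableAt ℝ (fun w => M w a B) z) {N : Matrix (Fin n) (Fin n) ℝ}
    (hMN : M z * N = 1) :
    pd A (fun w => (M w).det) z
      = (M z).det * (N * Matrix.of fun a B => pd A (fun w => M w a B) z).trace := by
  let D : ContinuousMultilinearMap ℝ (fun _ : Fin n => Fin n → ℝ) ℝ :=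
    { (Matrix.detRowAlternating : (Fin n → ℝ) [⋀^Fin n]→ₗ[ℝ] ℝ).toMultilinearMap with
      cont := Continuous.matrix_det (A := fun M : Fin n → Fin n → ℝ => M) continuous_id }
  have hrow : ∀ a, HasFDerivAt (fun w => M w a)
      (ContinuousLinearMap.pi fun B => fderiv ℝ (fun w => M w a B) z) z := fun a =>
    hasFDerivAt_pi.2 fun B => (hM a B).hasFDerivAt
  have hdet := HasFDerivAt.multilinear_comp D hrow
  change HasFDerivAt (fun w => (M w).det) _ z at hdet
  have hadj : (M z).adjugate = (M z).det • N := by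
    rw [← Matrix.mul_one (M z).adjugate, ← hMN, ← Matrix.mul_assoc, Matrix.adjugate_mul,
      Matrix.smul_mul, Matrix.one_mul]
  rw [pd, hdet.fderiv, sum_apply]
  have hterm : ∀ a, ((D.toContinuousLinearMap (fun j => M z j) a).comp
      (ContinuousLinearMap.pi fun B => fderiv ℝ (fun w => M w a B) z)) (Pi.single A 1)
      = ∑ B, (M z).adjugate B a * pd A (fun w => M w a B) z := fun a => by
    change ((M z).updateRow a fun B => pd A (fun w => M w a B) z).det = _
    rw [← Matrix.cramer_transpose_apply, Matrix.cramer_eq_adjugate_mulVec,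
      ← Matrix.adjugate_transpose]
    rfl
  rw [Finset.sum_congr rfl fun a _ => hterm a, hadj, Finset.sum_comm]
  simp only [Matrix.trace, Matrix.diag, Matrix.mul_apply, Matrix.of_apply, Finset.mul_sum,
    Matrix.smul_apply, smul_eq_mul, mul_assoc]

lemma contDiffOn_det {U : Set (Fin n → ℝ)} {M : (Fin n → ℝ) → Matrix (Fin n) (Fin n) ℝ}
    (hM : ∀ a B, ContDiffOn ℝ (⊤ : ℕ∞) (fun w => M w a B) U) :
    ContDiffOn ℝ (⊤ : ℕ∞) (fun w => (M w).det) U := by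
  simp only [Matrix.det_apply]
  exact ContDiffOn.sum fun σ _ => (contDiffOn_prod fun i _ => hM (σ i) i).const_smul _

/-- The entries of the inverse of a smooth matrix-valued function are smooth. -/
lemma contDiffOn_matrix_inv {U : Set (Fin n → ℝ)} {M N : (Fin n → ℝ) → Matrix (Fin n) (Fin n) ℝ}
    (hM : ∀ a B, ContDiffOn ℝ (⊤ : ℕ∞) (fun w => M w a B) U)
    (hMN : ∀ w ∈ U, M w * N w = 1) (A b : Fin n) :
    ContDiffOn ℝ (⊤ : ℕ∞) (fun w => N w A b) U := by
  have hdet : ∀ w ∈ U, (M w).det ≠ 0 := fun w hw h => by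
    have := congrArg Matrix.det (hMN w hw)
    rw [Matrix.det_mul, h, zero_mul, Matrix.det_one] at this
    exact zero_ne_one this
  have hN : ∀ w ∈ U, N w A b = ((M w).updateRow b (Pi.single A 1)).det * (M w).det⁻¹ := fun w hw => by
    rw [← Matrix.adjugate_apply, ← Matrix.mul_one (M w).adjugate, ← hMN w hw, ← Matrix.mul_assoc,
      Matrix.adjugate_mul, Matrix.smul_mul, Matrix.one_mul, Matrix.smul_apply, smul_eq_mul]
    field_simp [hdet w hw]
  refine ContDiffOn.congr (ContDiffOn.mul (contDiffOn_det fun a B => ?_)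
    ((contDiffOn_det hM).inv hdet)) hN
  by_cases h : a = b
  · subst h
    simpa only [Matrix.updateRow_self] using contDiffOn_const
  · simpa only [Matrix.updateRow_ne h] using hM a B

end PartialDerivatives

section Vielbein

open Matrix

variable {n : ℕ} {Q : QuadraticForm ℝ (EuclideanSpace ℝ (Fin n))} {lam : ℝ}

lemma gammaFlat_anticomm (hQ : ∀ x, Q x = lam * ‖x‖ ^ 2) (a b : Fin n) :
    gammaFlat Q a * gammaFlat Q b + gammaFlat Q b * gammaFlat Q a
      = (if a = b then 2 * lam else 0) • (1 : CliffordAlgebra Q) := by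
  rw [gammaFlat, gammaFlat, CliffordAlgebra.ι_mul_ι_add_swap, Algebra.algebraMap_eq_smul_one]
  congr 1
  rw [QuadraticMap.polar, hQ, hQ, hQ, ← mul_sub, ← mul_sub, norm_add_sq_real]
  simp only [EuclideanSpace.inner_single_left, PiLp.single_apply]
  split_ifs <;> (simp; try ring)

lemma diracBispinorScalar_eq (e eInv gup : (Fin n → ℝ) → Fin n → Fin n → ℝ)
    (f : (Fin n → ℝ) → ℝ) (w : Fin n → ℝ) :
    diracBispinorScalar Q lam e eInv gup f w
      = ∑ a, (∑ A, eInv w A a * pd A f w) • gammaFlat Q a := by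
  simp only [diracBispinorScalar, mul_smul_comm, smul_mul_assoc, mul_one, one_mul, sub_self,
    sub_zero, gammaCurved, Finset.smul_sum, Finset.sum_smul, smul_smul]
  rw [Finset.sum_comm]
  simp only [mul_comm]

lemma invMetric_eq {M N G : Matrix (Fin n) (Fin n) ℝ} (hMN : M * N = 1)
    (hG : Mᵀ * M * G = 1) : G = N * Nᵀ := by
  have hNM : N * M = 1 := mul_eq_one_comm.mp hMN
  have h : N * Nᵀ * (Mᵀ * M) = 1 := by
    rw [Matrix.mul_assoc, ← Matrix.mul_assoc Nᵀ, ← transpose_mul, hMN, transpose_one,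
      Matrix.one_mul, hNM]
  rw [← Matrix.one_mul G, ← h, Matrix.mul_assoc, hG, Matrix.mul_one]

lemma pd_glowE {e : (Fin n → ℝ) → Fin n → Fin n → ℝ} {z : Fin n → ℝ}
    (he : ∀ a A, DifferentiableAt ℝ (fun w => e w a A) z) (A D B : Fin n) :
    pd A (fun w => glowE e w D B) z
      = metricDeriv (of (e z)) (fun A => of fun b C => pd A (fun w => e w b C) z) A D B := by
  exact pd_sum_mul A (he · D) (he · B)

lemma spinConnE_eq {e eInv gup : (Fin n → ℝ) → Fin n → Fin n → ℝ} {z : Fin n → ℝ}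
    (he : ∀ a A, DifferentiableAt ℝ (fun w => e w a A) z)
    (hG : of (gup z) = of (eInv z) * (of (eInv z))ᵀ) (b A c : Fin n) :
    spinConnE e eInv gup b A c z
      = spinMatrix (of (e z)) (of (eInv z)) (fun A => of fun b C => pd A (fun w => e w b C) z)
        A b c := by
  have hΓ : ∀ B C, christ gup (glowE e) B A C z
      = (of (gup z) * christMatrix (metricDeriv (of (e z))
          (fun A => of fun b C => pd A (fun w => e w b C) z)) A) B C := fun B C => by
    simp only [christ, christLow, pd_glowE he, Matrix.mul_apply, christMatrix, of_apply]
  rw [spinConnE, spinMatrix, ← hG, Matrix.mul_assoc, Matrix.sub_apply]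
  congr 1
  rw [← Matrix.mul_assoc, Matrix.mul_apply, Finset.sum_comm]
  refine Finset.sum_congr rfl fun C _ => ?_
  rw [Matrix.mul_apply, Finset.sum_mul]
  exact Finset.sum_congr rfl fun B _ => by rw [hΓ]; rfl

end Vielbein

/-- the square of the bispinor Dirac operator projected onto the singlet is the
Laplace–Beltrami operator: `D(D(f·1)) = λ·(Δ_{ρ_g}f)·1` pointwise on `U`, where the bispinor
covariant derivative is `∇_A F := ∂_A F − (Ω_A·F − F·Ω_A)` and `D F := Σ_A γ^A·(∇_A F)`.
The partial derivative of the Clifford-algebra-valued function `D(f·1)` is encoded weakly,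
through linear functionals `φ`. -/
theorem stmt18 {n : ℕ} (U : Set (Fin n → ℝ)) (hU : IsOpen U)
    (lam : ℝ) (hlam : lam ≠ 0)
    (Q : QuadraticForm ℝ (EuclideanSpace ℝ (Fin n)))
    (hQ : ∀ x, Q x = lam * ‖x‖ ^ 2)
    -- the vielbein and its pointwise inverse
    (e eInv : (Fin n → ℝ) → Fin n → Fin n → ℝ)
    (he : ∀ a A, ContDiffOn ℝ (⊤ : ℕ∞) (fun z => e z a A) U)
    (heInv : ∀ z ∈ U, ∀ a b, ∑ A, e z a A * eInv z A b = if a = b then 1 else 0)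
    (heInv' : ∀ z ∈ U, ∀ A B, ∑ a, eInv z A a * e z a B = if A = B then 1 else 0)
    (hdet : ∀ z ∈ U, 0 < rhoE e z)
    -- the inverse `g^{AB}` of the induced metric `g_{AB} = Σ_a e^a{}_A e^a{}_B`
    (gup : (Fin n → ℝ) → Fin n → Fin n → ℝ)
    (hgup : ∀ z ∈ U, ∀ A C, ∑ B, glowE e z A B * gup z B C = if A = C then 1 else 0)
    -- the smooth scalar function `f`
    (f : (Fin n → ℝ) → ℝ) (hf : ContDiffOn ℝ (⊤ : ℕ∞) f U)
    -- `dDF A = ∂_A (D(f·1))`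
    (dDF : Fin n → (Fin n → ℝ) → CliffordAlgebra Q)
    (hdDF : ∀ (φ : Module.Dual ℝ (CliffordAlgebra Q)) (A : Fin n), ∀ z ∈ U,
      φ (dDF A z) = pd A (fun w => φ (diracBispinorScalar Q lam e eInv gup f w)) z) :
    ∀ z ∈ U,
      ∑ A, gammaCurved Q eInv A z *
          (dDF A z
            - (OmegaSpin Q lam e eInv gup A z * diracBispinorScalar Q lam e eInv gup f z
               - diracBispinorScalar Q lam e eInv gup f z * OmegaSpin Q lam e eInv gup A z))
        = (lam * lap (rhoE e) gup f z) • (1 : CliffordAlgebra Q) := by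
  intro z hz
  have hzU := hU.mem_nhds hz
  let M : (Fin n → ℝ) → Matrix (Fin n) (Fin n) ℝ := fun w => Matrix.of (e w)
  let N : (Fin n → ℝ) → Matrix (Fin n) (Fin n) ℝ := fun w => Matrix.of (eInv w)
  let dM : Fin n → Matrix (Fin n) (Fin n) ℝ :=
    fun A => Matrix.of fun b C => pd A (fun w => e w b C) z
  let W : Fin n → (Fin n → ℝ) → ℝ := fun B w => ∑ C, gup w B C * pd C f w
  let V : Fin n → (Fin n → ℝ) → ℝ := fun a w => ∑ A, eInv w A a * pd A f w
  let dW : Fin n → Fin n → ℝ := fun A B => pd A (W B) z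
  let γ : Fin n → CliffordAlgebra Q := gammaFlat Q
  have hγ := gammaFlat_anticomm hQ
  have hMN : ∀ w ∈ U, M w * N w = 1 := fun w hw => by
    ext a b
    simpa only [Matrix.mul_apply, Matrix.one_apply] using! heInv w hw a b
  have hNM : ∀ w ∈ U, N w * M w = 1 := fun w hw => mul_eq_one_comm.mp (hMN w hw)
  have hG : ∀ w ∈ U, Matrix.of (gup w) = N w * (N w).transpose := fun w hw => by
    refine invMetric_eq (hMN w hw) ?_
    ext A C
    simpa only [Matrix.mul_apply, Matrix.one_apply] using! hgup w hw A C
  have hGapply : ∀ w ∈ U, ∀ A B, gup w A B = ∑ a, eInv w A a * eInv w B a := fun w hw A B =>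
    congrFun (congrFun (hG w hw) A) B
  -- smoothness
  have heInvC : ∀ A a, ContDiffOn ℝ (⊤ : ℕ∞) (fun w => eInv w A a) U :=
    contDiffOn_matrix_inv (M := M) (N := N) he hMN
  have hgC : ∀ A B, ContDiffOn ℝ (⊤ : ℕ∞) (fun w => gup w A B) U := fun A B =>
    (ContDiffOn.sum fun a _ => (heInvC A a).mul (heInvC B a)).congr fun w hw => hGapply w hw A B
  have hpf : ∀ A, ContDiffOn ℝ (⊤ : ℕ∞) (pd A f) U := fun A => contDiffOn_pd A hU hf
  have hdiff : ∀ {F : (Fin n → ℝ) → ℝ}, ContDiffOn ℝ (⊤ : ℕ∞) F U → DifferentiableAt ℝ F z :=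
    fun h => (h.contDiffAt hzU).differentiableAt (by simp)
  have hWd : ∀ B, DifferentiableAt ℝ (W B) z := fun B =>
    hdiff (ContDiffOn.sum fun C _ => (hgC B C).mul (hpf C))
  have hVd : ∀ a, DifferentiableAt ℝ (V a) z := fun a =>
    hdiff (ContDiffOn.sum fun A _ => (heInvC A a).mul (hpf A))
  have hed : ∀ a A, DifferentiableAt ℝ (fun w => e w a A) z := fun a A => hdiff (he a A)
  have hgd : ∀ D B, DifferentiableAt ℝ (fun w => glowE e w D B) z := fun D B =>
    hdiff (ContDiffOn.sum fun a _ => (he a D).mul (he a B))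
  -- the gradient in flat and in curved components
  have hWvec : ∀ w ∈ U, (fun B => W B w) = (N w * (N w).transpose).mulVec fun C => pd C f w :=
    fun w hw => by rw [← hG w hw]; rfl
  have hVW : ∀ w ∈ U, (fun a => V a w) = (M w).mulVec fun B => W B w := fun w hw => by
    rw [hWvec w hw, Matrix.mulVec_mulVec, ← Matrix.mul_assoc, hMN w hw, Matrix.one_mul]
    rfl
  have hgW : ∀ w ∈ U, ∀ D, pd D f w = ∑ B, glowE e w D B * W B w := fun w hw D => by
    have h : ((M w).transpose * M w).mulVec (fun B => W B w) = fun C => pd C f w := by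
      rw [hWvec w hw, Matrix.mulVec_mulVec, Matrix.mul_assoc, ← Matrix.mul_assoc (M w), hMN w hw,
        Matrix.one_mul, ← Matrix.transpose_mul, hNM w hw, Matrix.transpose_one, Matrix.one_mulVec]
    exact (congrFun h D).symm
  have hdV : ∀ A, (fun b => pd A (V b) z)
      = (dM A).mulVec (fun B => W B z) + (M z).mulVec (dW A) := fun A => by
    ext b
    rw [pd_congr A hU hz fun w hw => congrFun (hVW w hw) b]
    change pd A (fun w => ∑ B, e w b B * W B w) z = _
    rw [pd_sum_mul A (hed b) hWd]
    rfl
  have hHess : ∀ A D, pd A (pd D f) z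
      = ((metricDeriv (M z) dM A).mulVec (fun B => W B z)
        + ((M z).transpose * M z).mulVec (dW A)) D := fun A D => by
    rw [pd_congr A hU hz fun w hw => hgW w hw D, pd_sum_mul A (hgd D) hWd]
    simp only [pd_glowE hed]
    rfl
  -- the covariant derivative of the gradient
  let P : Matrix (Fin n) (Fin n) ℝ := Matrix.of fun B A =>
    (dW A + (N z * (N z).transpose * christMatrix (metricDeriv (M z) dM) A).mulVec
      (fun B => W B z)) B
  let T : Matrix (Fin n) (Fin n) ℝ := (M z).transpose * M z * P
  have hT : T.IsSymm := Matrix.IsSymm.ext fun D A =>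
    covDeriv_lower_symm dM (hMN z hz) (fun B => W B z) dW
      (fun A D => by rw [← hHess, ← hHess, pd_comm A D (hf.contDiffAt hzU)]) D A
  have hdD : ∀ A, dDF A z = ∑ a, pd A (V a) z • γ a := fun A => by
    rw [← sub_eq_zero, ← Module.forall_dual_apply_eq_zero_iff ℝ]
    intro φ
    rw [map_sub, hdDF φ A z hz, sub_eq_zero]
    simp only [diracBispinorScalar_eq, map_sum, map_smul, smul_eq_mul]
    refine (pd_sum_mul A hVd fun a => differentiableAt_const (φ (γ a))).trans ?_
    simp [pd]
  have hD : diracBispinorScalar Q lam e eInv gup f z = ∑ a, V a z • γ a :=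
    diracBispinorScalar_eq e eInv gup f z
  have hcov : ∀ A, dDF A z
      - (OmegaSpin Q lam e eInv gup A z * diracBispinorScalar Q lam e eInv gup f z
        - diracBispinorScalar Q lam e eInv gup f z * OmegaSpin Q lam e eInv gup A z)
      = ∑ b, (M z * P) b A • γ b := fun A => by
    have hΩ : OmegaSpin Q lam e eInv gup A z = (1 / (8 * lam)) • ∑ b, ∑ c,
        spinMatrix (M z) (N z) dM A b c • (γ c * γ b - γ b * γ c) := by
      simp only [OmegaSpin, spinConnE_eq hed (hG z hz)]
      rfl
    rw [hD, hΩ, spin_commutator hlam hγ _ (spinMatrix_transpose dM (hMN z hz) A) fun a => V a z,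
      hdD, sub_neg_eq_add, ← Finset.sum_add_distrib]
    refine Finset.sum_congr rfl fun b _ => ?_
    rw [← add_smul]
    congr 1
    have h := congrFun (covDeriv_flat dM (hNM z hz) (fun B => W B z) dW A) b
    rw [← hdV A, ← hVW z hz] at h
    exact h
  let Y : Matrix (Fin n) (Fin n) ℝ := (N z).transpose * T * N z
  have hYsymm : Y.IsSymm := by
    simp only [Y, Matrix.IsSymm, Matrix.transpose_mul, Matrix.transpose_transpose, hT.eq,
      Matrix.mul_assoc]
  have hYP : Y = M z * P * N z := by
    simp only [Y, T, ← Matrix.mul_assoc]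
    rw [← Matrix.transpose_mul, hMN z hz, Matrix.transpose_one, Matrix.one_mul]
  have hLHS : ∑ A, gammaCurved Q eInv A z * ∑ b, (M z * P) b A • γ b
      = ∑ a, ∑ b, Y a b • (γ a * γ b) := by
    have hYab : ∀ a b, Y a b = ∑ A, (M z * P) b A * N z A a := fun a b => by
      rw [← hYsymm.apply, hYP, Matrix.mul_apply]
    simp only [hYab, gammaCurved, Finset.sum_mul_sum, smul_mul_smul_comm, Finset.sum_smul]
    rw [Finset.sum_comm]
    refine Finset.sum_congr rfl fun a _ => ?_
    rw [Finset.sum_comm]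
    simp only [mul_comm ((M z * P) _ _)]
    rfl
  have htrace : Y.trace = ∑ A, pd A (W A) z
      + ∑ C, (N z * dM C).trace * W C z := by
    rw [hYP, Matrix.trace_mul_comm, ← Matrix.mul_assoc, hNM z hz, Matrix.one_mul]
    simp only [← sum_christ_contract dM (hMN z hz), Finset.sum_mul]
    rw [Finset.sum_comm, ← Finset.sum_add_distrib]
    rfl
  have hlap : lap (rhoE e) gup f z = Y.trace := by
    have hρ : ∀ A, pd A (rhoE e) z = rhoE e z * (N z * dM A).trace := fun A =>
      pd_det A (M := M) hed (hMN z hz)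
    have hρd : DifferentiableAt ℝ (rhoE e) z := hdiff (contDiffOn_det (M := M) he)
    have hρ0 : rhoE e z ≠ 0 := (hdet z hz).ne'
    have hterm : ∀ A, ∑ B, pd A (fun w => rhoE e w * gup w A B * pd B f w) z
        = rhoE e z * (pd A (W A) z + (N z * dM A).trace * W A z) := fun A => by
      rw [← pd_sum A fun B => (hρd.fun_mul (hdiff (hgC A B))).fun_mul (hdiff (hpf B))]
      simp only [mul_assoc, ← Finset.mul_sum]
      rw [pd_mul A hρd (hWd A), hρ]
      ring
    rw [lap, Finset.sum_congr rfl fun A _ => hterm A, ← Finset.mul_sum, inv_mul_cancel_left₀ hρ0,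
      Finset.sum_add_distrib, htrace]
  rw [Finset.sum_congr rfl fun A _ => by rw [hcov A], hLHS, sum_symm_smul_clifford hγ Y hYsymm, hlap]
end
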